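/- arXiv:math/0702159 — 2 statements merged into one kernel-verified Lean document; each statement's English description precedes it below -/
import Mathlib

section
/- Let R be a commutative Noetherian ring, a an ideal of R, and M a finitely generated R-module with c := cd_R(a, M) ≠ −∞. Let W be the set of primes p ∈ Supp_R M with dim R/p = c and cd_R(a, R/p) = c, and let X := W ∩ Ass_R M. If the R-module H^c_a(M) is representable, then X ⊆ Att_R H^c_a(M). -/
/- Common definitions: local cohomology modules, cohomological dimension, module dimension,
secondary representations and attached primes. -/

open CategoryTheory TensorProduct

/-- The `i`-th local cohomology module `H^i_a(M)`, as a type with its `R`-module structure. -/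
noncomputable def TopLC (R : Type) [CommRing R] (a : Ideal R) (i : ℕ)
    (M : Type) [AddCommGroup M] [Module R M] : Type :=
  ((localCohomology a i).obj (ModuleCat.of R M))

noncomputable instance (R : Type) [CommRing R] (a : Ideal R) (i : ℕ)
    (M : Type) [AddCommGroup M] [Module R M] : AddCommGroup (TopLC R a i M) :=
  inferInstanceAs (AddCommGroup ((localCohomology a i).obj (ModuleCat.of R M)))

noncomputable instance (R : Type) [CommRing R] (a : Ideal R) (i : ℕ)
    (M : Type) [AddCommGroup M] [Module R M] : Module R (TopLC R a i M) :=
  inferInstanceAs (Module R ((localCohomology a i).obj (ModuleCat.of R M)))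

/-- The cohomological dimension `cd_R(a, M) = sup { i | H^i_a(M) ≠ 0 }`,
with value `⊥` if all local cohomology modules vanish. -/
noncomputable def cohDim (R : Type) [CommRing R] (a : Ideal R)
    (M : Type) [AddCommGroup M] [Module R M] : WithBot ℕ∞ :=
  sSup {n : WithBot ℕ∞ | ∃ i : ℕ, n = (i : ℕ) ∧ Nontrivial (TopLC R a i M)}

/-- The (Krull) dimension of a module, i.e. the Krull dimension of its support. -/
noncomputable def moduleDim (R : Type) [CommRing R]
    (M : Type) [AddCommGroup M] [Module R M] : WithBot ℕ∞ :=
  Order.krullDim (Module.support R M)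

/-- `Assh_R M`: the associated primes `p` of `M` with `dim R/p = dim M`. -/
noncomputable def Assh (R : Type) [CommRing R]
    (M : Type) [AddCommGroup M] [Module R M] : Set (Ideal R) :=
  { p | p ∈ associatedPrimes R M ∧ ringKrullDim (R ⧸ p) = moduleDim R M }

/-- A submodule `S` is secondary if `S ≠ 0` and every `r : R` acts on `S` either
surjectively or nilpotently. -/
def IsSecondarySub (R : Type) [CommRing R] {M : Type} [AddCommGroup M] [Module R M]
    (S : Submodule R M) : Prop :=
  S ≠ ⊥ ∧ ∀ r : R, (∀ m ∈ S, ∃ s ∈ S, r • s = m) ∨ (∃ n : ℕ, ∀ m ∈ S, r ^ n • m = 0)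

/-- A module is representable if it is the (finite) sum of secondary submodules. -/
def IsRepresentable (R : Type) [CommRing R] (M : Type) [AddCommGroup M] [Module R M] : Prop :=
  ∃ (n : ℕ) (S : Fin n → Submodule R M), (∀ i, IsSecondarySub R (S i)) ∧ (⨆ i, S i) = ⊤

/-- A minimal secondary representation: secondary submodules summing to the whole module,
with pairwise distinct attached primes, none contained in the sum of the others. -/
def IsMinimalRep (R : Type) [CommRing R] {M : Type} [AddCommGroup M] [Module R M]
    {n : ℕ} (S : Fin n → Submodule R M) : Prop :=
  (∀ i, IsSecondarySub R (S i)) ∧ (⨆ i, S i) = ⊤ ∧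
    (Function.Injective fun i => (S i).annihilator.radical) ∧
    ∀ j, ¬ (S j ≤ ⨆ i ∈ ({j}ᶜ : Set (Fin n)), S i)

/-- The attached primes of a module: the radicals of the annihilators of the terms of a
minimal secondary representation. -/
def AttachedPrimes (R : Type) [CommRing R] (M : Type) [AddCommGroup M] [Module R M] :
    Set (Ideal R) :=
  { p | ∃ (n : ℕ) (S : Fin n → Submodule R M), IsMinimalRep R S ∧
      ∃ i, p = (S i).annihilator.radical }

/-- `stab b N = ⟨b⟩N = ⋂ₙ bⁿN`. -/
def stab {R M : Type} [CommRing R] [AddCommGroup M] [Module R M]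
    (b : Ideal R) (N : Submodule R M) : Submodule R M :=
  ⨅ n : ℕ, b ^ n • N

open Limits Opposite

namespace ExtCocycle

section Abelian

variable {D : Type*} [Category* D] [Abelian D]

/-- The morphism out of homology induced by a morphism vanishing on boundaries. -/
noncomputable def homologyDesc (K : ChainComplex D ℕ) (n : ℕ) {A : D} (k : K.X n ⟶ A)
    (hk : K.d (n + 1) n ≫ k = 0) : K.homology n ⟶ A :=
  K.homologyι n ≫ K.descOpcycles k (n + 1) (by simp) hk

lemma homologyMap_comp_homologyDesc {K L : ChainComplex D ℕ} (f : K ⟶ L) (n : ℕ) {A : D}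
    (k : L.X n ⟶ A) (hk : L.d (n + 1) n ≫ k = 0) (hk' : K.d (n + 1) n ≫ f.f n ≫ k = 0) :
    HomologicalComplex.homologyMap f n ≫ homologyDesc L n k hk =
      homologyDesc K n (f.f n ≫ k) hk' := by
  unfold homologyDesc
  rw [HomologicalComplex.homologyι_naturality_assoc]
  congr 1
  rw [← cancel_epi (K.pOpcycles n)]
  simp

lemma homologyDesc_comp (K : ChainComplex D ℕ) (n : ℕ) {A B : D} (k : K.X n ⟶ A)
    (hk : K.d (n + 1) n ≫ k = 0) (g : A ⟶ B) (hk' : K.d (n + 1) n ≫ k ≫ g = 0) :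
    homologyDesc K n k hk ≫ g = homologyDesc K n (k ≫ g) hk' := by
  unfold homologyDesc
  rw [Category.assoc]
  congr 1
  rw [← cancel_epi (K.pOpcycles n)]
  simp

lemma homologyDesc_sub (K : ChainComplex D ℕ) (n : ℕ) {A : D} (k k' : K.X n ⟶ A)
    (hk : K.d (n + 1) n ≫ k = 0) (hk' : K.d (n + 1) n ≫ k' = 0)
    (hkk' : K.d (n + 1) n ≫ (k - k') = 0) :
    homologyDesc K n (k - k') hkk' = homologyDesc K n k hk - homologyDesc K n k' hk' := by
  unfold homologyDesc
  rw [← Preadditive.comp_sub]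
  congr 1
  rw [← cancel_epi (K.pOpcycles n)]
  simp

lemma exists_homologyDesc_eq (K : ChainComplex D ℕ) (n : ℕ) {A : D} [Injective A]
    (m : K.homology n ⟶ A) :
    ∃ (k : K.X n ⟶ A) (hk : K.d (n + 1) n ≫ k = 0), homologyDesc K n k hk = m := by
  refine ⟨K.pOpcycles n ≫ Injective.factorThru m (K.homologyι n), by simp, ?_⟩
  unfold homologyDesc
  have : K.descOpcycles (K.pOpcycles n ≫ Injective.factorThru m (K.homologyι n)) (n + 1)
      (by simp) (by simp) = Injective.factorThru m (K.homologyι n) := by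
    rw [← cancel_epi (K.pOpcycles n)]
    simp
  rw [this, Injective.comp_factorThru]

lemma homologyDesc_eq_zero_iff (K : ChainComplex D ℕ) (n : ℕ) {A : D} [Injective A]
    (k : K.X n ⟶ A) (hk : K.d (n + 1) n ≫ k = 0) :
    homologyDesc K n k hk = 0 ↔ ∃ (j : ℕ) (g : K.X j ⟶ A), k = K.d n j ≫ g := by
  constructor
  · intro h
    have ex : (ShortComplex.mk _ _ (K.homologyι_comp_fromOpcycles n
        ((ComplexShape.down ℕ).next n))).Exact :=
      ShortComplex.exact_of_f_is_kernel _ (K.homologyIsKernel n _ rfl)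
    refine ⟨_, ex.descToInjective _ h, ?_⟩
    have := ex.comp_descToInjective _ h
    have h2 := congrArg (fun z => K.pOpcycles n ≫ z) this
    simpa using h2.symm
  · rintro ⟨j, g, rfl⟩
    exact K.homologyι_descOpcycles_eq_zero_of_boundary (K.d n j ≫ g) (n + 1) (by simp) g rfl

end Abelian

variable {R : Type} [CommRing R] {C : Type 1} [Category.{0} C] [Abelian C] [Linear R C]

variable (R) in
/-- The contravariant functor `Hom(-, Y)`, as a covariant functor to the opposite category. -/
noncomputable abbrev homOp (Y : C) : C ⥤ (ModuleCat.{0} R)ᵒᵖ :=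
  ((linearYoneda R C).obj Y).rightOp

variable (R) in
/-- A morphism `φ : X ⟶ Y`, seen as a morphism `R ⟶ Hom(X, Y)` in the opposite category. -/
noncomputable def pick {X Y : C} (φ : X ⟶ Y) : (homOp R Y).obj X ⟶ op (ModuleCat.of R R) :=
  (ModuleCat.ofHom (LinearMap.toSpanSingleton R (X ⟶ Y) φ)).op

lemma hom_ext_one {A : (ModuleCat.{0} R)ᵒᵖ} {f g : A ⟶ op (ModuleCat.of R R)}
    (h : f.unop.hom (1 : R) = g.unop.hom (1 : R)) : f = g := by
  apply Quiver.Hom.unop_inj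
  ext
  exact h

lemma map_comp_pick {X X' Y : C} (f : X' ⟶ X) (φ : X ⟶ Y) :
    (homOp R Y).map f ≫ pick R φ = pick R (f ≫ φ) := by
  apply hom_ext_one
  change f ≫ ((1 : R) • φ) = (1 : R) • (f ≫ φ)
  rw [one_smul, one_smul]

lemma pick_zero {X Y : C} : pick R (0 : X ⟶ Y) = 0 := by
  apply hom_ext_one
  exact smul_zero (A := X ⟶ Y) (1 : R)

lemma pick_surjective {X Y : C} (g : (homOp R Y).obj X ⟶ op (ModuleCat.of R R)) :
    ∃ φ : X ⟶ Y, pick R φ = g :=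
  ⟨g.unop.hom (1 : R), hom_ext_one (one_smul R _)⟩

lemma pick_injective {X Y : C} : Function.Injective (pick R : (X ⟶ Y) → _) := by
  intro φ ψ h
  have h1 : (1 : R) • φ = (1 : R) • ψ := congrArg (fun z => z.unop.hom (1 : R)) h
  rwa [one_smul, one_smul] at h1

lemma pick_comp {X Y Y' : C} (φ : X ⟶ Y) (g : Y ⟶ Y') :
    pick R (φ ≫ g) = (((linearYoneda R C).map g).rightOp.app X) ≫ pick R φ := by
  apply hom_ext_one
  change (1 : R) • (φ ≫ g) = ((1 : R) • φ) ≫ g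
  rw [one_smul, one_smul]

lemma pick_smul {X Y : C} (r : R) (φ : X ⟶ Y) :
    pick R (r • φ) = pick R φ ≫
      (ModuleCat.ofHom (LinearMap.toSpanSingleton R R r)).op := by
  apply hom_ext_one
  change (1 : R) • (r • φ) = ((1 : R) • r) • φ
  rw [one_smul, one_smul]

lemma pick_sub {X Y : C} (φ ψ : X ⟶ Y) : pick R (φ - ψ) = pick R φ - pick R ψ := by
  apply hom_ext_one
  change (1 : R) • (φ - ψ) = (1 : R) • φ - (1 : R) • ψ
  rw [smul_sub]

variable {X : C} (P : ProjectiveResolution X) {Y : C} {n : ℕ}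

variable (R Y) in
/-- The complex `Hom(P, Y)`, as a chain complex in the opposite category. -/
noncomputable abbrev homComplex : ChainComplex (ModuleCat.{0} R)ᵒᵖ ℕ :=
  ((homOp R Y).mapHomologicalComplex _).obj P.complex

variable (R) in
/-- A cochain of `Hom(P, Y)`, as a morphism to `R` in the opposite category. -/
noncomputable def cochain (φ : P.complex.X n ⟶ Y) :
    (homComplex R P Y).X n ⟶ op (ModuleCat.of R R) :=
  pick R φ

lemma d_comp_cochain {m : ℕ} (φ : P.complex.X n ⟶ Y) :
    (homComplex R P Y).d m n ≫ cochain R P φ = cochain R P (P.complex.d m n ≫ φ) :=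
  map_comp_pick _ _

lemma d_comp_cochain_eq_zero {φ : P.complex.X n ⟶ Y} (hφ : P.complex.d (n + 1) n ≫ φ = 0) :
    (homComplex R P Y).d (n + 1) n ≫ cochain R P φ = 0 := by
  rw [d_comp_cochain, hφ]
  exact pick_zero

variable [EnoughProjectives C]

variable (R Y n) in
/-- The left derived functors of `Hom(-, Y)`, computed by a projective resolution. -/
noncomputable def derivedIso :
    ((homOp R Y).leftDerived n).obj X ≅ (homComplex R P Y).homology n :=
  P.isoLeftDerivedObj (homOp R Y) n

variable (R) in
/-- The morphism on homology defined by a cocycle. -/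
noncomputable def extClassHom (φ : P.complex.X n ⟶ Y) (hφ : P.complex.d (n + 1) n ≫ φ = 0) :
    ((homOp R Y).leftDerived n).obj X ⟶ op (ModuleCat.of R R) :=
  (derivedIso R P Y n).hom ≫
    homologyDesc (homComplex R P Y) n (cochain R P φ) (d_comp_cochain_eq_zero P hφ)

variable (R) in
/-- The class in `Ext` of a cocycle on a projective resolution. -/
noncomputable def extClass (φ : P.complex.X n ⟶ Y) (hφ : P.complex.d (n + 1) n ≫ φ = 0) :
    ((Ext R C n).obj (op X)).obj Y :=
  (extClassHom R P φ hφ).unop.hom (1 : R)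

lemma exists_extClass_eq (c : ((Ext R C n).obj (op X)).obj Y) :
    ∃ (φ : P.complex.X n ⟶ Y) (hφ : P.complex.d (n + 1) n ≫ φ = 0), extClass R P φ hφ = c := by
  let m : ((homOp R Y).leftDerived n).obj X ⟶ op (ModuleCat.of R R) :=
    Quiver.Hom.op (X := ModuleCat.of R R) (Y := ((Ext R C n).obj (op X)).obj Y)
      (ModuleCat.ofHom (LinearMap.toSpanSingleton R _ c))
  obtain ⟨k, hk, h⟩ := exists_homologyDesc_eq (homComplex R P Y) n
    ((derivedIso R P Y n).inv ≫ m)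
  obtain ⟨φ, hφ⟩ := pick_surjective (R := R) (X := P.complex.X n) (Y := Y) k
  obtain rfl : cochain R P φ = k := hφ
  have h0 : P.complex.d (n + 1) n ≫ φ = 0 := by
    apply pick_injective (R := R)
    rw [pick_zero]
    exact (d_comp_cochain P φ).symm.trans hk
  refine ⟨φ, h0, ?_⟩
  have h1 : extClassHom R P φ h0 = m := by
    unfold extClassHom
    rw [h, Iso.hom_inv_id_assoc]
  unfold extClass
  rw [h1]
  exact one_smul R c

lemma extClass_eq_zero_iff (φ : P.complex.X n ⟶ Y) (hφ : P.complex.d (n + 1) n ≫ φ = 0) :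
    extClass R P φ hφ = 0 ↔
      ∃ (j : ℕ) (g : P.complex.X j ⟶ Y), φ = P.complex.d n j ≫ g := by
  have h1 : extClass R P φ hφ = 0 ↔ homologyDesc (homComplex R P Y) n (cochain R P φ)
      (d_comp_cochain_eq_zero P hφ) = 0 := by
    rw [← cancel_epi (derivedIso R P Y n).hom, comp_zero]
    constructor
    · intro h
      exact hom_ext_one h
    · intro h
      have h2 : extClassHom R P φ hφ = 0 := h
      unfold extClass
      rw [h2]
      rfl
  rw [h1, homologyDesc_eq_zero_iff]
  constructor
  · rintro ⟨j, g, h⟩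
    obtain ⟨ψ, hψ⟩ := pick_surjective (R := R) (X := P.complex.X j) (Y := Y) g
    obtain rfl : cochain R P ψ = g := hψ
    exact ⟨j, ψ, pick_injective (R := R) (h.trans (d_comp_cochain P ψ))⟩
  · rintro ⟨j, ψ, rfl⟩
    exact ⟨j, cochain R P ψ, (d_comp_cochain P ψ).symm⟩

lemma ext_map_extClass {X' : C} (P' : ProjectiveResolution X') (f : X' ⟶ X)
    (F : P'.complex ⟶ P.complex) (hF : F.f 0 ≫ P.π.f 0 = P'.π.f 0 ≫ f)
    (φ : P.complex.X n ⟶ Y) (hφ : P.complex.d (n + 1) n ≫ φ = 0)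
    (hφ' : P'.complex.d (n + 1) n ≫ F.f n ≫ φ = 0) :
    (((Ext R C n).map f.op).app Y).hom (extClass R P φ hφ) = extClass R P' (F.f n ≫ φ) hφ' := by
  let G : homComplex R P' Y ⟶ homComplex R P Y := ((homOp R Y).mapHomologicalComplex _).map F
  have h : ((homOp R Y).leftDerived n).map f ≫ (derivedIso R P Y n).hom =
      (derivedIso R P' Y n).hom ≫ HomologicalComplex.homologyMap G n :=
    P'.isoLeftDerivedObj_hom_naturality f P F hF (homOp R Y) n
  have hG : G.f n ≫ cochain R P φ = cochain R P' (F.f n ≫ φ) := map_comp_pick _ _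
  have h2 := homologyMap_comp_homologyDesc G n (cochain R P φ) (d_comp_cochain_eq_zero P hφ)
    (by rw [hG]; exact d_comp_cochain_eq_zero P' hφ')
  simp only [hG] at h2
  have key : ((homOp R Y).leftDerived n).map f ≫ extClassHom R P φ hφ =
      extClassHom R P' (F.f n ≫ φ) hφ' := by
    unfold extClassHom
    rw [← Category.assoc, h, Category.assoc, h2]
  exact congrArg (fun z => z.unop.hom (1 : R)) key

lemma ext_map_extClass' {Y' : C} (g : Y ⟶ Y')
    (φ : P.complex.X n ⟶ Y) (hφ : P.complex.d (n + 1) n ≫ φ = 0)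
    (hφ' : P.complex.d (n + 1) n ≫ φ ≫ g = 0) :
    (((Ext R C n).obj (op X)).map g).hom (extClass R P φ hφ) = extClass R P (φ ≫ g) hφ' := by
  let α : homOp R Y' ⟶ homOp R Y := NatTrans.rightOp ((linearYoneda R C).map g)
  let G : homComplex R P Y' ⟶ homComplex R P Y :=
    (NatTrans.mapHomologicalComplex α _).app P.complex
  have h : (NatTrans.leftDerived α n).app X = (derivedIso R P Y' n).hom ≫
      HomologicalComplex.homologyMap G n ≫ (derivedIso R P Y n).inv :=
    ProjectiveResolution.leftDerived_app_eq α P n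
  have hG : G.f n ≫ cochain R P φ = cochain R P (φ ≫ g) := (pick_comp φ g).symm
  have h2 := homologyMap_comp_homologyDesc G n (cochain R P φ) (d_comp_cochain_eq_zero P hφ)
    (by rw [hG]; exact d_comp_cochain_eq_zero P hφ')
  simp only [hG] at h2
  have key : (NatTrans.leftDerived α n).app X ≫ extClassHom R P φ hφ =
      extClassHom R P (φ ≫ g) hφ' := by
    unfold extClassHom
    rw [h, Category.assoc, Category.assoc, Iso.inv_hom_id_assoc, h2]
  exact congrArg (fun z => z.unop.hom (1 : R)) key

lemma smul_extClass (r : R) (φ : P.complex.X n ⟶ Y) (hφ : P.complex.d (n + 1) n ≫ φ = 0)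
    (hφ' : P.complex.d (n + 1) n ≫ (r • φ) = 0) :
    r • extClass R P φ hφ = extClass R P (r • φ) hφ' := by
  let ρ : op (ModuleCat.of R R) ⟶ op (ModuleCat.of R R) :=
    (ModuleCat.ofHom (LinearMap.toSpanSingleton R R r)).op
  have hρ : cochain R P φ ≫ ρ = cochain R P (r • φ) := (pick_smul r φ).symm
  have h := homologyDesc_comp (homComplex R P Y) n (cochain R P φ) (d_comp_cochain_eq_zero P hφ) ρ
    (by rw [hρ]; exact d_comp_cochain_eq_zero P hφ')
  simp only [hρ] at h
  have key : extClassHom R P φ hφ ≫ ρ = extClassHom R P (r • φ) hφ' := by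
    unfold extClassHom
    rw [Category.assoc, h]
  have h3 : (extClassHom R P φ hφ).unop.hom ((1 : R) • r) = extClass R P (r • φ) hφ' :=
    congrArg (fun z => z.unop.hom (1 : R)) key
  rw [← h3, one_smul]
  have h4 := (extClassHom R P φ hφ).unop.hom.map_smul r (1 : R)
  rw [smul_eq_mul, mul_one] at h4
  exact h4.symm

lemma extClass_sub (φ ψ : P.complex.X n ⟶ Y) (hφ : P.complex.d (n + 1) n ≫ φ = 0)
    (hψ : P.complex.d (n + 1) n ≫ ψ = 0) (hφψ : P.complex.d (n + 1) n ≫ (φ - ψ) = 0) :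
    extClass R P (φ - ψ) hφψ = extClass R P φ hφ - extClass R P ψ hψ := by
  have h : cochain R P (φ - ψ) = cochain R P φ - cochain R P ψ := pick_sub φ ψ
  have h1 := homologyDesc_sub (homComplex R P Y) n (cochain R P φ) (cochain R P ψ)
    (d_comp_cochain_eq_zero P hφ) (d_comp_cochain_eq_zero P hψ)
    (by rw [← h]; exact d_comp_cochain_eq_zero P hφψ)
  simp only [← h] at h1
  have key : extClassHom R P (φ - ψ) hφψ = extClassHom R P φ hφ - extClassHom R P ψ hψ := by
    unfold extClassHom
    rw [h1, Preadditive.comp_sub]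
  exact congrArg (fun z => z.unop.hom (1 : R)) key

lemma extClass_smul_eq_zero (r : R) (hr : r • 𝟙 X = 0) (φ : P.complex.X n ⟶ Y)
    (hφ : P.complex.d (n + 1) n ≫ (r • φ) = 0) (hφ' : P.complex.d (n + 1) n ≫ φ = 0) :
    extClass R P (r • φ) hφ = 0 := by
  have hF : (r • 𝟙 P.complex : P.complex ⟶ P.complex).f n ≫ φ = r • φ := by simp
  let p : P.complex.X 0 ⟶ X := P.π.f 0
  have hp : (r • 𝟙 P.complex : P.complex ⟶ P.complex).f 0 ≫ p = p ≫ 0 := by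
    rw [HomologicalComplex.smul_f_apply, HomologicalComplex.id_f, Linear.smul_comp,
      Category.id_comp, ← hr, Linear.comp_smul, Category.comp_id]
  have hp0 : (0 : P.complex ⟶ P.complex).f 0 ≫ p = p ≫ 0 := by
    rw [HomologicalComplex.zero_f, zero_comp, comp_zero]
  have h1 := ext_map_extClass (R := R) P P 0 (r • 𝟙 P.complex) hp φ hφ' (by rw [hF]; exact hφ)
  have h0 := ext_map_extClass (R := R) P P 0 (0 : P.complex ⟶ P.complex) hp0 φ hφ' (by
    rw [HomologicalComplex.zero_f, zero_comp, comp_zero])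
  have h2 : extClass R P ((0 : P.complex ⟶ P.complex).f n ≫ φ) (by
      rw [HomologicalComplex.zero_f, zero_comp, comp_zero]) = 0 :=
    (extClass_eq_zero_iff P _ _).2 ⟨n, 0, by
      rw [HomologicalComplex.zero_f, zero_comp, comp_zero]⟩
  have h3 := (h1.symm.trans h0).trans h2
  simp only [hF] at h3
  exact h3

end ExtCocycle

namespace LC

variable {R : Type} [CommRing R] (a : Ideal R)

open localCohomology

section Cocycles

/-- A projective resolution of `R ⧸ a ^ t`. -/
noncomputable def proRes (t : ℕ) : ProjectiveResolution (ModuleCat.of R (R ⧸ a ^ t)) :=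
  projectiveResolution _

/-- The complex underlying the chosen projective resolution of `R ⧸ a ^ t`. -/
noncomputable def res (t : ℕ) : ChainComplex (ModuleCat.{0} R) ℕ := (proRes a t).complex

instance (t i : ℕ) : Projective ((res a t).X i) := (proRes a t).projective i

variable {a} in
/-- The projection `R ⧸ a ^ s → R ⧸ a ^ t` for `t ≤ s`. -/
noncomputable def proj {t s : ℕ} (h : t ≤ s) :
    ModuleCat.of R (R ⧸ a ^ s) ⟶ ModuleCat.of R (R ⧸ a ^ t) :=
  (ringModIdeals (idealPowersDiagram a)).map (homOfLE h).op

variable {a} in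
/-- The lift of `proj h` to resolutions. -/
noncomputable def trans {t s : ℕ} (h : t ≤ s) : res a s ⟶ res a t :=
  ProjectiveResolution.lift (proj h) (proRes a s) (proRes a t)

lemma trans_comm {t s : ℕ} (h : t ≤ s) :
    (trans h).f 0 ≫ (proRes a t).π.f 0 = (proRes a s).π.f 0 ≫ proj (a := a) h :=
  ProjectiveResolution.lift_commutes_zero _ _ _

variable {M : Type} [AddCommGroup M] [Module R M] {N : Type} [AddCommGroup N] [Module R N]
  {i : ℕ}

/-- The class in local cohomology of a cocycle. -/
noncomputable def cl (t : ℕ) (φ : (res a t).X i ⟶ ModuleCat.of R M)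
    (hφ : (res a t).d (i + 1) i ≫ φ = 0) : TopLC R a i M :=
  ((colimit.ι (diagram (idealPowersDiagram a) i) (op (op t))).app (ModuleCat.of R M)).hom
    (ExtCocycle.extClass R (proRes a t) φ hφ)

variable (M i) in
/-- The direct system of `Ext` modules computing local cohomology. -/
noncomputable def extSystem : ℕᵒᵖᵒᵖ ⥤ ModuleCat.{0} R :=
  diagram (idealPowersDiagram a) i ⋙ (evaluation _ _).obj (ModuleCat.of R M)

variable (M i) in
/-- The cocone on `extSystem` with point local cohomology. -/
noncomputable def extCocone : Cocone (extSystem a M i) :=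
  ((evaluation _ _).obj (ModuleCat.of R M)).mapCocone
    (colimit.cocone (diagram (idealPowersDiagram a) i))

variable (M i) in
/-- Local cohomology is the colimit of `extSystem`. -/
noncomputable def extCoconeIsColimit : IsColimit (extCocone a M i) :=
  isColimitOfPreserves _ (colimit.isColimit _)

lemma exists_cl_eq (c : TopLC R a i M) :
    ∃ (t : ℕ) (φ : (res a t).X i ⟶ ModuleCat.of R M) (hφ : (res a t).d (i + 1) i ≫ φ = 0),
      cl a t φ hφ = c := by
  obtain ⟨⟨⟨t⟩⟩, x, hx⟩ := Concrete.isColimit_exists_rep _ (extCoconeIsColimit a M i) c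
  obtain ⟨φ, hφ, rfl⟩ := ExtCocycle.exists_extClass_eq (proRes a t) (Y := ModuleCat.of R M) x
  exact ⟨t, φ, hφ, hx⟩

lemma trans_isCocycle {t s : ℕ} (h : t ≤ s) (φ : (res a t).X i ⟶ ModuleCat.of R M)
    (hφ : (res a t).d (i + 1) i ≫ φ = 0) : (res a s).d (i + 1) i ≫ (trans h).f i ≫ φ = 0 := by
  rw [← HomologicalComplex.Hom.comm_assoc, hφ, comp_zero]

lemma extSystem_map_extClass {t s : ℕ} (h : t ≤ s) (φ : (res a t).X i ⟶ ModuleCat.of R M)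
    (hφ : (res a t).d (i + 1) i ≫ φ = 0) :
    ((extSystem a M i).map (homOfLE h).op.op).hom (ExtCocycle.extClass R (proRes a t) φ hφ) =
      ExtCocycle.extClass R (proRes a s) ((trans h).f i ≫ φ) (trans_isCocycle a h φ hφ) :=
  ExtCocycle.ext_map_extClass (proRes a t) (proRes a s) (proj h) (trans h) (trans_comm a h) φ hφ _

lemma cl_trans {t s : ℕ} (h : t ≤ s) (φ : (res a t).X i ⟶ ModuleCat.of R M)
    (hφ : (res a t).d (i + 1) i ≫ φ = 0) :
    cl a s ((trans h).f i ≫ φ) (trans_isCocycle a h φ hφ) = cl a t φ hφ := by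
  have h1 := (extCocone a M i).w (homOfLE h).op.op
  have h2 := congrArg (fun z => z.hom (ExtCocycle.extClass R (proRes a t) φ hφ)) h1
  refine Eq.trans ?_ h2
  refine congrArg ((extCocone a M i).ι.app (op (op s))).hom ?_
  exact (extSystem_map_extClass a h φ hφ).symm

lemma cl_eq_zero_iff {t : ℕ} (φ : (res a t).X i ⟶ ModuleCat.of R M)
    (hφ : (res a t).d (i + 1) i ≫ φ = 0) :
    cl a t φ hφ = 0 ↔ ∃ (s : ℕ) (h : t ≤ s) (j : ℕ) (ψ : (res a s).X j ⟶ ModuleCat.of R M),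
      (trans h).f i ≫ φ = (res a s).d i j ≫ ψ := by
  constructor
  · intro h
    have h0 : ((extCocone a M i).ι.app (op (op t))).hom
        (ExtCocycle.extClass R (proRes a t) φ hφ) =
        ((extCocone a M i).ι.app (op (op t))).hom 0 := h.trans (_root_.map_zero _).symm
    obtain ⟨⟨⟨s⟩⟩, f, g, hfg⟩ := (Concrete.isColimit_rep_eq_iff_exists _
      (extCoconeIsColimit a M i) _ _).1 h0
    have hts : t ≤ s := f.unop.unop.le
    refine ⟨s, hts, (ExtCocycle.extClass_eq_zero_iff (R := R) (proRes a s) _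
      (trans_isCocycle a hts φ hφ)).1 ?_⟩
    exact (extSystem_map_extClass a hts φ hφ).symm.trans (hfg.trans (_root_.map_zero _))
  · rintro ⟨s, h, h1⟩
    rw [← cl_trans a h]
    have h2 := (ExtCocycle.extClass_eq_zero_iff (R := R) (proRes a s) _
      (trans_isCocycle a h φ hφ)).2 h1
    unfold cl
    rw [h2]
    exact _root_.map_zero _

variable (i) in
/-- The map induced on local cohomology by a linear map. -/
noncomputable def map (f : M →ₗ[R] N) : TopLC R a i M →ₗ[R] TopLC R a i N :=
  ((localCohomology a i).map (ModuleCat.ofHom f)).hom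

lemma map_cl (f : M →ₗ[R] N) {t : ℕ} (φ : (res a t).X i ⟶ ModuleCat.of R M)
    (hφ : (res a t).d (i + 1) i ≫ φ = 0)
    (hφ' : (res a t).d (i + 1) i ≫ φ ≫ ModuleCat.ofHom f = 0) :
    map a i f (cl a t φ hφ) = cl a t (φ ≫ ModuleCat.ofHom f) hφ' := by
  have h1 := (colimit.ι (diagram (idealPowersDiagram a) i) (op (op t))).naturality
    (ModuleCat.ofHom f)
  have h2 := congrArg (fun z => z.hom (ExtCocycle.extClass R (proRes a t) φ hφ)) h1
  refine h2.symm.trans ?_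
  refine congrArg ((colimit.ι (diagram (idealPowersDiagram a) i) (op (op t))).app
    (ModuleCat.of R N)).hom ?_
  exact ExtCocycle.ext_map_extClass' (proRes a t) (ModuleCat.ofHom f) φ hφ hφ'

lemma smul_cl (r : R) {t : ℕ} (φ : (res a t).X i ⟶ ModuleCat.of R M)
    (hφ : (res a t).d (i + 1) i ≫ φ = 0)
    (hφ' : (res a t).d (i + 1) i ≫ (r • φ) = 0) :
    r • cl a t φ hφ = cl a t (r • φ) hφ' := by
  unfold cl
  refine (map_smul _ r _).symm.trans (congrArg _ ?_)
  exact ExtCocycle.smul_extClass (proRes a t) r φ hφ hφ'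

lemma cl_sub {t : ℕ} (φ ψ : (res a t).X i ⟶ ModuleCat.of R M)
    (hφ : (res a t).d (i + 1) i ≫ φ = 0) (hψ : (res a t).d (i + 1) i ≫ ψ = 0)
    (hφψ : (res a t).d (i + 1) i ≫ (φ - ψ) = 0) :
    cl a t (φ - ψ) hφψ = cl a t φ hφ - cl a t ψ hψ := by
  unfold cl
  refine Eq.trans (congrArg _ ?_) (_root_.map_sub _ _ _)
  exact ExtCocycle.extClass_sub (proRes a t) φ ψ hφ hψ hφψ

lemma map_lsmul (r : R) (c : TopLC R a i M) :
    map a i (LinearMap.lsmul R M r) c = r • c := by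
  obtain ⟨t, φ, hφ, rfl⟩ := exists_cl_eq a c
  rw [smul_cl a r φ hφ (by rw [Linear.comp_smul, hφ, smul_zero]),
    map_cl a _ φ hφ (by rw [← Category.assoc, hφ, zero_comp])]
  rfl

lemma map_comp {L : Type} [AddCommGroup L] [Module R L] (f : M →ₗ[R] N) (g : N →ₗ[R] L)
    (c : TopLC R a i M) : map a i (g ∘ₗ f) c = map a i g (map a i f c) :=
  congrArg (fun z => z.hom c) ((localCohomology a i).map_comp (ModuleCat.ofHom f)
    (ModuleCat.ofHom g))

lemma map_zero (c : TopLC R a i M) : map a i (0 : M →ₗ[R] N) c = 0 := by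
  obtain ⟨t, φ, hφ, rfl⟩ := exists_cl_eq a c
  rw [map_cl a _ φ hφ (by rw [← Category.assoc, hφ, zero_comp]), cl_eq_zero_iff]
  exact ⟨t, le_rfl, i, 0, by simp⟩

lemma map_id (c : TopLC R a i M) : map a i LinearMap.id c = c :=
  congrArg (fun z => z.hom c) ((localCohomology a i).map_id (ModuleCat.of R M))

lemma exists_pow_smul_eq_zero {x : R} (hx : x ∈ a) (c : TopLC R a i M) :
    ∃ n : ℕ, x ^ n • c = 0 := by
  obtain ⟨t, φ, hφ, rfl⟩ := exists_cl_eq a c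
  refine ⟨t, ?_⟩
  have hφ' : (res a t).d (i + 1) i ≫ (x ^ t • φ) = 0 := by rw [Linear.comp_smul, hφ, smul_zero]
  rw [smul_cl a _ φ hφ hφ']
  have h0 : x ^ t • 𝟙 (ModuleCat.of R (R ⧸ a ^ t)) = 0 := by
    apply ModuleCat.hom_ext
    apply LinearMap.ext
    intro y
    obtain ⟨y, rfl⟩ := Ideal.Quotient.mk_surjective y
    change x ^ t • Ideal.Quotient.mk (a ^ t) y = 0
    rw [← Ideal.Quotient.mk_eq_mk, ← Submodule.Quotient.mk_smul,
      Submodule.Quotient.mk_eq_zero]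
    exact Ideal.mul_mem_right _ _ (Ideal.pow_mem_pow hx t)
  have h1 := ExtCocycle.extClass_smul_eq_zero (proRes a t) (x ^ t) h0 φ hφ' hφ
  unfold cl
  refine Eq.trans ?_ (_root_.map_zero (((colimit.ι (diagram (idealPowersDiagram a) i)
    (op (op t))).app (ModuleCat.of R M)).hom))
  exact congrArg _ h1

end Cocycles

section Exact

variable {A B C : Type} [AddCommGroup A] [Module R A] [AddCommGroup B] [Module R B]
  [AddCommGroup C] [Module R C] {f : A →ₗ[R] B} {g : B →ₗ[R] C} {i : ℕ}

lemma exists_lift {X : ModuleCat.{0} R} [Projective X] (hg : Function.Surjective g)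
    (φ : X ⟶ ModuleCat.of R C) : ∃ ψ : X ⟶ ModuleCat.of R B, ψ ≫ ModuleCat.ofHom g = φ := by
  have : Epi (ModuleCat.ofHom g) := (ModuleCat.epi_iff_surjective _).2 hg
  exact ⟨Projective.factorThru φ (ModuleCat.ofHom g), Projective.factorThru_comp _ _⟩

lemma exists_lift_of_exact {X : ModuleCat.{0} R} (hf : Function.Injective f)
    (hfg : Function.Exact f g) (φ : X ⟶ ModuleCat.of R B) (hφ : φ ≫ ModuleCat.ofHom g = 0) :
    ∃ ψ : X ⟶ ModuleCat.of R A, ψ ≫ ModuleCat.ofHom f = φ := by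
  have h : ∀ x, φ.hom x ∈ LinearMap.range f := fun x =>
    (hfg _).1 (congrArg (fun z => z.hom x) hφ)
  refine ⟨ModuleCat.ofHom ((LinearEquiv.ofInjective f hf).symm.toLinearMap ∘ₗ
    φ.hom.codRestrict (LinearMap.range f) h), ?_⟩
  apply ModuleCat.hom_ext
  apply LinearMap.ext
  intro x
  exact congrArg Subtype.val
    ((LinearEquiv.ofInjective f hf).apply_symm_apply (φ.hom.codRestrict (LinearMap.range f) h x))

lemma comp_ofHom_injective {X : ModuleCat.{0} R} (hf : Function.Injective f)
    {φ ψ : X ⟶ ModuleCat.of R A} (h : φ ≫ ModuleCat.ofHom f = ψ ≫ ModuleCat.ofHom f) :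
    φ = ψ := by
  have : Mono (ModuleCat.ofHom f) := (ModuleCat.mono_iff_injective _).2 hf
  exact (cancel_mono _).1 h

lemma comp_ofHom_zero {X : ModuleCat.{0} R} (hfg : Function.Exact f g)
    (φ : X ⟶ ModuleCat.of R A) : φ ≫ ModuleCat.ofHom f ≫ ModuleCat.ofHom g = 0 := by
  apply ModuleCat.hom_ext
  apply LinearMap.ext
  intro x
  exact hfg.apply_apply_eq_zero _

lemma exists_map_eq_of_map_eq_zero (hf : Function.Injective f) (hg : Function.Surjective g)
    (hfg : Function.Exact f g) (c : TopLC R a i B) (hc : map a i g c = 0) :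
    ∃ b, map a i f b = c := by
  obtain ⟨t, φ, hφ, rfl⟩ := exists_cl_eq a c
  rw [map_cl a g φ hφ (by rw [← Category.assoc, hφ, zero_comp]), cl_eq_zero_iff] at hc
  obtain ⟨s, hts, j, ψ, h⟩ := hc
  obtain ⟨ψ, rfl⟩ := exists_lift hg ψ
  have hd : (res a s).d (i + 1) i ≫ (res a s).d i j ≫ ψ = 0 := by
    rw [← Category.assoc, HomologicalComplex.d_comp_d, zero_comp]
  have hc := trans_isCocycle a hts φ hφ
  obtain ⟨χ, hχ⟩ := exists_lift_of_exact hf hfg ((trans hts).f i ≫ φ - (res a s).d i j ≫ ψ) (by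
    rw [Preadditive.sub_comp, sub_eq_zero]; simpa using h)
  have hχ1 : (res a s).d (i + 1) i ≫ χ ≫ ModuleCat.ofHom f = 0 := by
    rw [hχ, Preadditive.comp_sub, hc, hd, sub_zero]
  have hχ0 : (res a s).d (i + 1) i ≫ χ = 0 := by
    apply comp_ofHom_injective hf
    rw [Category.assoc, hχ1, zero_comp]
  refine ⟨cl a s χ hχ0, ?_⟩
  rw [map_cl a f χ hχ0 hχ1, ← cl_trans a hts φ hφ, ← sub_eq_zero,
    ← cl_sub a _ _ hχ1 hc (by rw [Preadditive.comp_sub, hχ1, hc, sub_zero]), cl_eq_zero_iff]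
  refine ⟨s, le_rfl, j, (trans (le_refl s)).f j ≫ (-ψ), ?_⟩
  rw [hχ, ← HomologicalComplex.Hom.comm_assoc]
  simp

lemma exists_eq_d_comp {t : ℕ} {χ : (res a t).X (i + 1) ⟶ ModuleCat.of R A} {j : ℕ}
    (ψ : (res a t).X j ⟶ ModuleCat.of R A) (h : χ = (res a t).d (i + 1) j ≫ ψ) :
    ∃ η : (res a t).X i ⟶ ModuleCat.of R A, χ = (res a t).d (i + 1) i ≫ η := by
  by_cases hj : j = i
  · subst hj
    exact ⟨ψ, h⟩
  · refine ⟨0, ?_⟩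
    rw [h, (res a t).shape _ _ (by simpa using hj), zero_comp, comp_zero]

lemma map_surjective_of_subsingleton (hf : Function.Injective f) (hg : Function.Surjective g)
    (hfg : Function.Exact f g) (hA : Subsingleton (TopLC R a (i + 1) A)) :
    Function.Surjective (map a i g) := by
  intro c
  obtain ⟨t, φ, hφ, rfl⟩ := exists_cl_eq a c
  obtain ⟨ψ, rfl⟩ := exists_lift hg φ
  obtain ⟨χ, hχ⟩ := exists_lift_of_exact hf hfg ((res a t).d (i + 1) i ≫ ψ) (by simpa using hφ)
  have hχ0 : (res a t).d (i + 1 + 1) (i + 1) ≫ χ = 0 := by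
    apply comp_ofHom_injective hf
    rw [Category.assoc, hχ]
    simp
  obtain ⟨s, hts, j, η, h⟩ := (cl_eq_zero_iff a χ hχ0).1 (Subsingleton.elim _ _)
  obtain ⟨η, h⟩ := exists_eq_d_comp a η h
  have h0 : (res a s).d (i + 1) i ≫ ((trans hts).f i ≫ ψ - η ≫ ModuleCat.ofHom f) = 0 := by
    rw [Preadditive.comp_sub, ← HomologicalComplex.Hom.comm_assoc, ← hχ, ← Category.assoc,
      ← Category.assoc, ← h, sub_self]
  have h1 : ((trans hts).f i ≫ ψ - η ≫ ModuleCat.ofHom f) ≫ ModuleCat.ofHom g =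
      (trans hts).f i ≫ ψ ≫ ModuleCat.ofHom g := by
    rw [Preadditive.sub_comp, Category.assoc, Category.assoc, comp_ofHom_zero hfg, sub_zero]
  refine ⟨cl a s _ h0, ?_⟩
  rw [map_cl a g _ h0 (by rw [← Category.assoc, h0, zero_comp]), ← cl_trans a hts]
  simp only [h1]

lemma map_injective_of_surjective (hf : Function.Injective f) (hg : Function.Surjective g)
    (hfg : Function.Exact f g) (h : Function.Surjective (map a i g)) :
    Function.Injective (map a (i + 1) f) := by
  rw [injective_iff_map_eq_zero]
  intro c hc
  obtain ⟨t, χ, hχ, rfl⟩ := exists_cl_eq a c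
  rw [map_cl a f χ hχ (by rw [← Category.assoc, hχ, zero_comp]), cl_eq_zero_iff] at hc
  obtain ⟨s, hts, j, η, hη⟩ := hc
  obtain ⟨η, hη⟩ := exists_eq_d_comp a η hη
  have hηg : (res a s).d (i + 1) i ≫ η ≫ ModuleCat.ofHom g = 0 := by
    rw [← Category.assoc, ← hη, Category.assoc, Category.assoc, comp_ofHom_zero hfg, comp_zero]
  obtain ⟨b, hb⟩ := h (cl a s _ hηg)
  obtain ⟨u, β, hβ, rfl⟩ := exists_cl_eq a b
  obtain ⟨v, hsv, huv⟩ : ∃ v, s ≤ v ∧ u ≤ v := ⟨max s u, le_max_left _ _, le_max_right _ _⟩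
  have hβ' := trans_isCocycle a huv β hβ
  have hβg : (res a v).d (i + 1) i ≫ ((trans huv).f i ≫ β) ≫ ModuleCat.ofHom g = 0 := by
    rw [← Category.assoc, hβ', zero_comp]
  have hsg := trans_isCocycle a hsv _ hηg
  rw [← cl_trans a huv β hβ, map_cl a g _ hβ' hβg, ← cl_trans a hsv _ hηg, eq_comm, ← sub_eq_zero,
    ← cl_sub a _ _ hsg hβg (by rw [Preadditive.comp_sub, hsg, hβg, sub_zero]),
    cl_eq_zero_iff] at hb
  obtain ⟨w, hvw, k, θ, hθ⟩ := hb
  obtain ⟨θ, rfl⟩ := exists_lift hg θ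
  obtain ⟨ζ, hζ⟩ := exists_lift_of_exact hf hfg ((trans hvw).f i ≫ ((trans hsv).f i ≫ η -
    (trans huv).f i ≫ β) - (res a w).d i k ≫ θ) (by
      rw [Preadditive.sub_comp, sub_eq_zero, Category.assoc, Category.assoc, ← hθ,
        Preadditive.sub_comp, Category.assoc])
  rw [← cl_trans a hts, ← cl_trans a hsv, ← cl_trans a hvw, cl_eq_zero_iff]
  refine ⟨w, le_rfl, i, (trans (le_refl w)).f i ≫ ζ, ?_⟩
  rw [← HomologicalComplex.Hom.comm_assoc]
  congr 1
  apply comp_ofHom_injective hf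
  rw [Category.assoc ((res a w).d (i + 1) i), hζ, Preadditive.comp_sub,
    HomologicalComplex.d_comp_d_assoc, zero_comp, sub_zero,
    ← HomologicalComplex.Hom.comm_assoc, Preadditive.comp_sub, hβ', sub_zero,
    ← HomologicalComplex.Hom.comm_assoc, ← hη]
  simp only [Category.assoc]

lemma subsingleton_of_exact (hf : Function.Injective f) (hg : Function.Surjective g)
    (hfg : Function.Exact f g) (hA : Subsingleton (TopLC R a i A))
    (hC : Subsingleton (TopLC R a i C)) : Subsingleton (TopLC R a i B) := by
  refine ⟨fun x y => ?_⟩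
  have h : ∀ z : TopLC R a i B, z = 0 := by
    intro z
    obtain ⟨b, rfl⟩ := exists_map_eq_of_map_eq_zero a hf hg hfg z (Subsingleton.elim _ _)
    rw [Subsingleton.elim b 0, _root_.map_zero]
  rw [h x, h y]

end Exact

section Torsion

variable (N : Type) [AddCommGroup N] [Module R N]

/-- The submodule of elements killed by a power of `a`. -/
def torsion : Submodule R N where
  carrier := {m | ∃ n : ℕ, ∀ r ∈ a ^ n, r • m = 0}
  zero_mem' := ⟨0, fun r _ => smul_zero r⟩
  add_mem' := by
    rintro x y ⟨n, hn⟩ ⟨m, hm⟩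
    refine ⟨n + m, fun r hr => ?_⟩
    rw [smul_add, hn r (Ideal.pow_le_pow_right (Nat.le_add_right n m) hr),
      hm r (Ideal.pow_le_pow_right (Nat.le_add_left m n) hr), add_zero]
  smul_mem' := by
    rintro s x ⟨n, hn⟩
    exact ⟨n, fun r hr => by rw [smul_comm, hn r hr, smul_zero]⟩

/-- A module is `a`-torsion if each element is killed by a power of `a`. -/
def IsTors : Prop := ∀ m : N, ∃ n : ℕ, ∀ r ∈ a ^ n, r • m = 0

lemma isTors_torsion : IsTors a (torsion a N) := by
  rintro ⟨m, n, hn⟩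
  exact ⟨n, fun r hr => Subtype.ext (hn r hr)⟩

variable {N}

lemma IsTors.quotient (h : IsTors a N) (K : Submodule R N) : IsTors a (N ⧸ K) := by
  intro m
  obtain ⟨m, rfl⟩ := K.mkQ_surjective m
  obtain ⟨n, hn⟩ := h m
  exact ⟨n, fun r hr => by rw [← _root_.map_smul, hn r hr, _root_.map_zero]⟩

lemma exists_pow_smul_eq_zero_of_fg {J : Type} [AddCommGroup J] [Module R J] [Module.Finite R J]
    (h : IsTors a N) (f : J →ₗ[R] N) : ∃ k : ℕ, ∀ r ∈ a ^ k, ∀ j : J, r • f j = 0 := by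
  obtain ⟨S, hS⟩ := Module.Finite.fg_top (R := R) (M := J)
  choose n hn using h
  refine ⟨S.sup fun j => n (f j), fun r hr j => ?_⟩
  have hj : j ∈ Submodule.span R (S : Set J) := by rw [hS]; trivial
  induction hj using Submodule.span_induction with
  | mem x hx => exact hn _ r (Ideal.pow_le_pow_right
      (Finset.le_sup (f := fun j => n (f j)) hx) hr)
  | zero => simp
  | add x y _ _ hx hy => rw [_root_.map_add, smul_add, hx, hy, add_zero]
  | smul s x _ hx => rw [_root_.map_smul, smul_comm, hx, smul_zero]

lemma injective_torsion [IsNoetherianRing R] (E : Type) [AddCommGroup E] [Module R E]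
    (hE : Module.Injective R E) : Module.Injective R (torsion a E) := by
  apply Module.Baer.injective
  intro J f
  obtain ⟨k, hk⟩ := exists_pow_smul_eq_zero_of_fg a (isTors_torsion a E) f
  obtain ⟨k', hk'⟩ := Ideal.exists_pow_inf_eq_pow_smul a J
  let n := k + k'
  have h1 : ∀ x (hx : x ∈ J), x ∈ a ^ n → f ⟨x, hx⟩ = 0 := by
    intro x hx hxn
    have h2 : x ∈ a ^ k • J := by
      have h3 : x ∈ a ^ n • (⊤ : Submodule R R) ⊓ J := ⟨by simpa using hxn, hx⟩
      rw [hk' n (Nat.le_add_left _ _), Nat.add_sub_cancel] at h3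
      exact Submodule.smul_mono le_rfl inf_le_right h3
    have h4 : a ^ k • J ≤ (LinearMap.ker f).map J.subtype := by
      rw [Submodule.smul_le]
      intro r hr y hy
      exact ⟨r • ⟨y, hy⟩, (f.map_smul _ _).trans (hk r hr ⟨y, hy⟩), rfl⟩
    obtain ⟨y, hy, rfl⟩ := h4 h2
    exact hy
  let φ : J →ₗ[R] R ⧸ a ^ n := (a ^ n).mkQ ∘ₗ J.subtype
  have hφ : LinearMap.ker φ ≤ LinearMap.ker ((torsion a E).subtype ∘ₗ f) := by
    rintro ⟨x, hx⟩ h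
    have : f ⟨x, hx⟩ = 0 := h1 x hx ((Submodule.Quotient.mk_eq_zero _).1 h)
    simp [this]
  obtain ⟨h, hh⟩ := hE.out ((LinearMap.ker φ).liftQ φ le_rfl)
    (LinearMap.ker_eq_bot.1 (Submodule.ker_liftQ_eq_bot _ _ _ le_rfl))
    ((LinearMap.ker φ).liftQ _ hφ)
  have he : h (Submodule.Quotient.mk 1) ∈ torsion a E := by
    refine ⟨n, fun r hr => ?_⟩
    rw [← _root_.map_smul, ← Submodule.Quotient.mk_smul, smul_eq_mul, mul_one,
      (Submodule.Quotient.mk_eq_zero _).2 hr, _root_.map_zero]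
  refine ⟨LinearMap.toSpanSingleton R _ ⟨_, he⟩, fun x hx => ?_⟩
  apply Subtype.ext
  have h3 := hh (Submodule.Quotient.mk ⟨x, hx⟩)
  rw [Submodule.liftQ_apply, Submodule.liftQ_apply] at h3
  change x • h (Submodule.Quotient.mk 1) = f ⟨x, hx⟩
  rw [← _root_.map_smul, ← Submodule.Quotient.mk_smul, smul_eq_mul, mul_one]
  exact h3

end Torsion

section Vanishing

variable {N : Type} [AddCommGroup N] [Module R N]

/-- The augmentation of the chosen resolution of `R ⧸ a ^ t`. -/
noncomputable def aug (t : ℕ) : (res a t).X 0 ⟶ ModuleCat.of R (R ⧸ a ^ t) :=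
  (proRes a t).π.f 0

lemma trans_aug {t s : ℕ} (h : t ≤ s) : (trans h).f 0 ≫ aug a t = aug a s ≫ proj h :=
  trans_comm a h

lemma d_aug (t : ℕ) : (res a t).d 1 0 ≫ aug a t = 0 :=
  (proRes a t).complex_d_comp_π_f_zero

lemma exists_aug_comp_eq {t : ℕ} {X : ModuleCat.{0} R} (φ : (res a t).X 0 ⟶ X)
    (hφ : (res a t).d 1 0 ≫ φ = 0) : ∃ ψ, aug a t ≫ ψ = φ := by
  obtain ⟨ψ, hψ⟩ := CokernelCofork.IsColimit.desc' (proRes a t).isColimitCokernelCofork φ hφ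
  exact ⟨ψ, hψ⟩

lemma map_zero_surjective {B C : Type} [AddCommGroup B] [Module R B] [AddCommGroup C] [Module R C]
    (hB : IsTors a B) (g : B →ₗ[R] C) (hg : Function.Surjective g) :
    Function.Surjective (map a 0 g) := by
  intro c
  obtain ⟨t, φ, hφ, rfl⟩ := exists_cl_eq a c
  obtain ⟨ψ, rfl⟩ := exists_aug_comp_eq a φ hφ
  obtain ⟨y, hy⟩ := hg (ψ.hom (Submodule.Quotient.mk 1))
  obtain ⟨s, hs⟩ := hB y
  let u := max t s
  let χ : ModuleCat.of R (R ⧸ a ^ u) ⟶ ModuleCat.of R B :=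
    ModuleCat.ofHom ((a ^ u).liftQ (LinearMap.toSpanSingleton R B y) fun r hr =>
      hs r (Ideal.pow_le_pow_right (le_max_right _ _) hr))
  have hχ : χ ≫ ModuleCat.ofHom g = proj (le_max_left t s) ≫ ψ := by
    apply ModuleCat.hom_ext
    apply LinearMap.ext
    intro r
    obtain ⟨r, rfl⟩ := Submodule.mkQ_surjective _ r
    change g (r • y) = ψ.hom (Submodule.Quotient.mk r)
    rw [_root_.map_smul, hy, ← _root_.map_smul, ← Submodule.Quotient.mk_smul, smul_eq_mul, mul_one]
  have h0 : (res a u).d (0 + 1) 0 ≫ aug a u ≫ χ = 0 := by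
    rw [← Category.assoc, d_aug, zero_comp]
  refine ⟨cl a u _ h0, ?_⟩
  rw [map_cl a g _ h0 (by rw [← Category.assoc, h0, zero_comp]),
    ← cl_trans a (le_max_left t s : t ≤ u)]
  have e : (aug a u ≫ χ) ≫ ModuleCat.ofHom g =
      (trans (le_max_left t s : t ≤ u)).f 0 ≫ aug a t ≫ ψ := by
    rw [Category.assoc, hχ, ← Category.assoc, ← trans_aug, Category.assoc]
  simp only [e]
  rfl

lemma subsingleton_of_injective (hN : Module.Injective R N) (i : ℕ) :
    Subsingleton (TopLC R a (i + 1) N) := by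
  have : Injective (ModuleCat.of R N) := Module.injective_object_of_injective_module R N
  refine subsingleton_of_forall_eq 0 fun c => ?_
  obtain ⟨t, φ, hφ, rfl⟩ := exists_cl_eq a c
  rw [cl_eq_zero_iff]
  have ex : (ShortComplex.mk _ _ ((res a t).d_comp_d (i + 2) (i + 1) i)).Exact :=
    (proRes a t).exact_succ i
  refine ⟨t, le_rfl, i, (trans (le_refl t)).f i ≫ ex.descToInjective φ hφ, ?_⟩
  rw [← HomologicalComplex.Hom.comm_assoc]
  congr 1
  exact (ex.comp_descToInjective φ hφ).symm

lemma subsingleton_of_isTors [IsNoetherianRing R] (hN : IsTors a N) (i : ℕ) :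
    Subsingleton (TopLC R a (i + 1) N) := by
  induction i generalizing N with
  | zero => ?_
  | succ i ih => ?_
  all_goals
    let E := Injective.under (ModuleCat.of R N)
    have hE : Module.Injective R E :=
      Module.injective_module_of_injective_object R E (inj :=
        inferInstanceAs (Injective (Injective.under (ModuleCat.of R N))))
    have hE' := injective_torsion a E hE
    have hι := (ModuleCat.mono_iff_injective (Injective.ι (ModuleCat.of R N))).1 inferInstance
    let ι : N →ₗ[R] E := (Injective.ι (ModuleCat.of R N)).hom
    let f : N →ₗ[R] torsion a E := ι.codRestrict _ fun m => by
      obtain ⟨n, hn⟩ := hN m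
      exact ⟨n, fun r hr => by rw [← _root_.map_smul, hn r hr, _root_.map_zero]⟩
    have hf : Function.Injective f := fun x y h => hι (congrArg Subtype.val h)
    let g := (LinearMap.range f).mkQ
    have hg : Function.Surjective g := Submodule.mkQ_surjective _
    have hfg : Function.Exact f g := LinearMap.exact_map_mkQ_range f
    have hQ := (isTors_torsion a E).quotient a (LinearMap.range f)
  · have h := map_injective_of_surjective a hf hg hfg
      (map_zero_surjective a (isTors_torsion a E) g hg)
    have := subsingleton_of_injective a hE' 0
    exact h.subsingleton
  · have := ih hQ
    have h := map_injective_of_surjective a (i := i + 1) hf hg hfg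
      (Function.surjective_to_subsingleton _)
    have := subsingleton_of_injective a hE' (i + 1)
    exact h.subsingleton

end Vanishing

section Support

variable {M : Type} [AddCommGroup M] [Module R M]

lemma exists_ne_zero_hom [Module.Finite R M] (q : PrimeSpectrum R) (hq : q ∈ Module.support R M) :
    ∃ f : M →ₗ[R] R ⧸ q.asIdeal, f ≠ 0 := by
  let K := q.asIdeal.ResidueField
  have hV : Nontrivial (K ⊗[R] M) :=
    (Module.mem_support_iff_nontrivial_residueField_tensorProduct q).1 hq
  obtain ⟨v, hv⟩ := exists_ne (0 : K ⊗[R] M)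
  obtain ⟨l, hl⟩ : ∃ l : Module.Dual K (K ⊗[R] M), l v ≠ 0 := by
    by_contra! h
    exact hv ((Module.forall_dual_apply_eq_zero_iff K v).1 h)
  let h : M →ₗ[R] K := l.restrictScalars R ∘ₗ TensorProduct.mk R K M 1
  obtain ⟨m₀, hm₀⟩ : ∃ m, h m ≠ 0 := by
    by_contra! h0
    refine hl ?_
    clear hl hv
    induction v using TensorProduct.induction_on with
    | zero => exact _root_.map_zero l
    | tmul k m =>
      have : k ⊗ₜ[R] m = k • ((1 : K) ⊗ₜ[R] m) := by
        rw [TensorProduct.smul_tmul', smul_eq_mul, mul_one]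
      rw [this, _root_.map_smul]
      exact (congrArg (k • ·) (h0 m)).trans (smul_zero k)
    | add x y hx hy => rw [_root_.map_add, hx, hy, add_zero]
  classical
  obtain ⟨S, hS⟩ := Module.Finite.fg_top (R := R) (M := M)
  obtain ⟨⟨b, hb⟩, hbS⟩ := IsLocalization.exist_integer_multiples_of_finset
    (nonZeroDivisors (R ⧸ q.asIdeal)) (S.image h)
  obtain ⟨r, rfl⟩ := Ideal.Quotient.mk_surjective b
  let ι : (R ⧸ q.asIdeal) →ₗ[R] K := (Algebra.linearMap (R ⧸ q.asIdeal) K).restrictScalars R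
  have hι : Function.Injective ι := IsFractionRing.injective (R ⧸ q.asIdeal) K
  have hr : ∀ m, (r • h) m = Ideal.Quotient.mk q.asIdeal r • h m := fun m =>
    algebra_compatible_smul (R ⧸ q.asIdeal) r (h m)
  have hmem : ∀ m, (r • h) m ∈ LinearMap.range ι := by
    intro m
    have hm : m ∈ Submodule.span R (S : Set M) := by rw [hS]; trivial
    induction hm using Submodule.span_induction with
    | mem x hx =>
      obtain ⟨z, hz⟩ := hbS _ (Finset.mem_image_of_mem h hx)
      exact ⟨z, hz.trans (hr x).symm⟩
    | zero => exact _root_.map_zero (r • h) ▸ zero_mem _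
    | add x y _ _ hx hy => exact _root_.map_add (r • h) x y ▸ add_mem hx hy
    | smul s x _ hx => exact _root_.map_smul (r • h) s x ▸ Submodule.smul_mem _ s hx
  let e := LinearEquiv.ofInjective ι hι
  refine ⟨e.symm.toLinearMap ∘ₗ (r • h).codRestrict _ hmem,
    fun h0 => ?_⟩
  have h1 := (LinearEquiv.map_eq_zero_iff e.symm).1 (LinearMap.congr_fun h0 m₀)
  have h2 : (r • h) m₀ = 0 := congrArg Subtype.val h1
  rw [hr, Algebra.smul_def] at h2
  exact (mul_ne_zero ((_root_.map_ne_zero_iff _ (IsFractionRing.injective (R ⧸ q.asIdeal) K)).2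
    (nonZeroDivisors.ne_zero hb)) hm₀) h2

lemma lt_of_mem_support_quotient {q q' : PrimeSpectrum R} {J : Submodule R (R ⧸ q.asIdeal)}
    (hJ : J ≠ ⊥) (hq' : q' ∈ Module.support R ((R ⧸ q.asIdeal) ⧸ J)) : q < q' := by
  have h := Module.annihilator_le_of_mem_support hq'
  obtain ⟨y, hy, hy0⟩ := Submodule.exists_mem_ne_zero_of_ne_bot hJ
  obtain ⟨y, rfl⟩ := Submodule.mkQ_surjective _ y
  have h1 : ∀ r z : R, r * z ∈ q.asIdeal →
      r • J.mkQ (q.asIdeal.mkQ z) = 0 := by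
    intro r z hrz
    rw [← _root_.map_smul, ← _root_.map_smul, smul_eq_mul]
    have : q.asIdeal.mkQ (r * z) = 0 := (Submodule.Quotient.mk_eq_zero _).2 hrz
    rw [this, _root_.map_zero]
  refine lt_of_le_of_ne (fun r hr => h ?_) ?_
  · rw [Module.mem_annihilator]
    intro m
    obtain ⟨m, rfl⟩ := Submodule.mkQ_surjective _ m
    obtain ⟨m, rfl⟩ := Submodule.mkQ_surjective _ m
    exact h1 r m (q.asIdeal.mul_mem_right _ hr)
  · rintro rfl
    apply hy0
    rw [Submodule.mkQ_apply, Submodule.Quotient.mk_eq_zero]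
    apply h
    rw [Module.mem_annihilator]
    intro m
    obtain ⟨m, rfl⟩ := Submodule.mkQ_surjective _ m
    obtain ⟨m, rfl⟩ := Submodule.mkQ_surjective _ m
    rw [← _root_.map_smul, Submodule.mkQ_apply, Submodule.Quotient.mk_eq_zero, ← _root_.map_smul,
      smul_eq_mul, mul_comm, ← smul_eq_mul, _root_.map_smul]
    exact J.smul_mem _ hy

lemma ringKrullDim_quotient_lt {q q' : PrimeSpectrum R} (h : q < q') {n : ℕ}
    (hn : ringKrullDim (R ⧸ q.asIdeal) < (n + 1 : ℕ)) : ringKrullDim (R ⧸ q'.asIdeal) < n := by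
  obtain ⟨r, hr, hrq⟩ := Set.exists_of_ssubset (show (q.asIdeal : Set R) ⊂ q'.asIdeal from h)
  have h1 := ringKrullDim_succ_le_of_surjective (Ideal.Quotient.factor h.le)
    (Ideal.Quotient.factor_surjective h.le) (r := Ideal.Quotient.mk _ r)
    (mem_nonZeroDivisors_of_ne_zero (by rwa [Ne, Ideal.Quotient.eq_zero_iff_mem]))
    (by rw [Ideal.Quotient.factor_mk, Ideal.Quotient.eq_zero_iff_mem]; exact hr)
  have h2 := h1.trans_lt hn
  revert h2
  generalize ringKrullDim (R ⧸ q'.asIdeal) = d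
  intro h2
  push_cast at h2
  exact lt_of_add_lt_add_right h2

lemma lsmul_injective {q : PrimeSpectrum R} {x : R} (hx : x ∉ q.asIdeal) :
    Function.Injective (LinearMap.lsmul R (R ⧸ q.asIdeal) x) := by
  rw [injective_iff_map_eq_zero]
  intro y hy
  obtain ⟨y, rfl⟩ := Submodule.mkQ_surjective _ y
  rw [LinearMap.lsmul_apply, ← _root_.map_smul, Submodule.mkQ_apply,
    Submodule.Quotient.mk_eq_zero] at hy
  rw [Submodule.mkQ_apply, Submodule.Quotient.mk_eq_zero]
  exact (q.isPrime.mem_or_mem hy).resolve_left hx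

lemma range_lsmul_ne_bot {q : PrimeSpectrum R} {x : R} (hx : x ∉ q.asIdeal) :
    LinearMap.range (LinearMap.lsmul R (R ⧸ q.asIdeal) x) ≠ ⊥ := by
  intro h
  rw [LinearMap.range_eq_bot] at h
  have h1 := congrArg (fun z => z (Submodule.Quotient.mk 1)) h
  apply hx
  have h2 : (Submodule.Quotient.mk (x • 1) : R ⧸ q.asIdeal) = 0 := h1
  rwa [Submodule.Quotient.mk_eq_zero, smul_eq_mul, mul_one] at h2

lemma mem_of_mem_support_lsmul {q q' : PrimeSpectrum R} {x : R}
    (h : q' ∈ Module.support R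
      ((R ⧸ q.asIdeal) ⧸ LinearMap.range (LinearMap.lsmul R (R ⧸ q.asIdeal) x))) :
    x ∈ q'.asIdeal := by
  apply Module.annihilator_le_of_mem_support h
  rw [Module.mem_annihilator]
  intro m
  obtain ⟨m, rfl⟩ := Submodule.mkQ_surjective _ m
  rw [← _root_.map_smul, Submodule.mkQ_apply, Submodule.Quotient.mk_eq_zero]
  exact ⟨m, rfl⟩

end Support

section Bounds

variable {N : Type} [AddCommGroup N] [Module R N] {i : ℕ}

lemma subsingleton_succ {q : PrimeSpectrum R} {x : R} (hx : x ∉ q.asIdeal) (hxa : x ∈ a)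
    (h : Subsingleton (TopLC R a i
      ((R ⧸ q.asIdeal) ⧸ LinearMap.range (LinearMap.lsmul R (R ⧸ q.asIdeal) x)))) :
    Subsingleton (TopLC R a (i + 1) (R ⧸ q.asIdeal)) := by
  have h1 := map_injective_of_surjective a (i := i) (lsmul_injective hx)
    (Submodule.mkQ_surjective _) (LinearMap.exact_map_mkQ_range _)
    (Function.surjective_to_subsingleton _)
  refine subsingleton_of_forall_eq 0 fun c => ?_
  obtain ⟨n, hn⟩ := exists_pow_smul_eq_zero a hxa c
  induction n with
  | zero => simpa using hn
  | succ n ih =>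
    apply ih
    apply h1
    rw [map_lsmul, smul_smul, ← pow_succ', hn, _root_.map_zero]

variable [IsNoetherianRing R]

lemma subsingleton_of_support [Module.Finite R N]
    (h : ∀ q ∈ Module.support R N, Subsingleton (TopLC R a i (R ⧸ q.asIdeal))) :
    Subsingleton (TopLC R a i N) := by
  have h0 : ∀ (L : Type) [AddCommGroup L] [Module R L], (∀ c : TopLC R a i L, c = 0) →
    Subsingleton (TopLC R a i L) := fun L _ _ hL => ⟨fun x y => by rw [hL x, hL y]⟩
  induction ‹Module.Finite R N› using
    IsNoetherianRing.induction_on_isQuotientEquivQuotientPrime R with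
  | subsingleton L =>
    apply h0
    intro c
    rw [← map_id a c, Subsingleton.elim (LinearMap.id : L →ₗ[R] L) 0, map_zero]
  | quotient L p e =>
    have := h p (by
      rw [e.support_eq, Module.mem_support_iff_of_finite, Ideal.annihilator_quotient])
    apply h0
    intro c
    rw [← map_id a c, ← e.symm_comp, map_comp, Subsingleton.elim (map a i e.toLinearMap c) 0,
      _root_.map_zero]
  | exact A B C f g hf hg hfg hA hC =>
    exact subsingleton_of_exact a hf hg hfg
      (hA fun q hq => h q (Module.support_subset_of_injective f hf hq))
      (hC fun q hq => h q (Module.support_subset_of_surjective g hg hq))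

lemma subsingleton_of_le {I : Ideal R} (h : a ≤ I) : Subsingleton (TopLC R a (i + 1) (R ⧸ I)) := by
  apply subsingleton_of_isTors
  intro m
  refine ⟨1, fun r hr => ?_⟩
  obtain ⟨m, rfl⟩ := Submodule.mkQ_surjective _ m
  rw [← _root_.map_smul, Submodule.mkQ_apply, Submodule.Quotient.mk_eq_zero]
  rw [pow_one] at hr
  exact I.mul_mem_right _ (h hr)

/-- Grothendieck vanishing for cyclic prime quotients. -/
lemma subsingleton_of_ringKrullDim_lt {q : PrimeSpectrum R} {n : ℕ}
    (hq : ringKrullDim (R ⧸ q.asIdeal) < n) (hi : n ≤ i) :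
    Subsingleton (TopLC R a i (R ⧸ q.asIdeal)) := by
  induction n generalizing q i with
  | zero =>
    exact absurd hq (not_lt.2 (by exact_mod_cast ringKrullDim_nonneg_of_nontrivial))
  | succ n ih =>
    obtain ⟨i, rfl⟩ : ∃ j, i = j + 1 := ⟨i - 1, by omega⟩
    by_cases ha : a ≤ q.asIdeal
    · exact subsingleton_of_le a ha
    · obtain ⟨x, hxa, hx⟩ := Set.not_subset.1 ha
      refine subsingleton_succ a hx hxa (subsingleton_of_support a fun q' hq' => ?_)
      exact ih (ringKrullDim_quotient_lt
        (lt_of_mem_support_quotient (range_lsmul_ne_bot hx) hq') hq) (by omega)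

lemma subsingleton_of_card_lt (s : Finset R) {q : PrimeSpectrum R} (hs : (s : Set R) ⊆ a)
    (hq : ∀ p : PrimeSpectrum R, q ≤ p → (s : Set R) ⊆ p.asIdeal → a ≤ p.asIdeal)
    (hi : s.card < i) : Subsingleton (TopLC R a i (R ⧸ q.asIdeal)) := by
  classical
  induction s using Finset.induction_on generalizing q i with
  | empty =>
    obtain ⟨i, rfl⟩ : ∃ j, i = j + 1 := ⟨i - 1, by simp at hi; omega⟩
    exact subsingleton_of_le a (hq q le_rfl (by simp))
  | insert x s hxs ih =>
    rw [Finset.card_insert_of_notMem hxs] at hi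
    rw [Finset.coe_insert, Set.insert_subset_iff] at hs
    obtain ⟨i, rfl⟩ : ∃ j, i = j + 1 := ⟨i - 1, by omega⟩
    simp only [Finset.coe_insert, Set.insert_subset_iff] at hq
    by_cases hx : x ∈ q.asIdeal
    · exact ih hs.2 (fun p hp hsp => hq p hp ⟨hp hx, hsp⟩) (by omega)
    · refine subsingleton_succ a hx hs.1 (subsingleton_of_support a fun q' hq' => ?_)
      have hlt := lt_of_mem_support_quotient (range_lsmul_ne_bot hx) hq'
      have hxq' := mem_of_mem_support_lsmul hq'
      exact ih hs.2 (fun p hp hsp => hq p (hlt.le.trans hp) ⟨hp hxq', hsp⟩) (by omega)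

lemma exists_bound : ∃ n, ∀ i, n < i → ∀ q : PrimeSpectrum R,
    Subsingleton (TopLC R a i (R ⧸ q.asIdeal)) := by
  obtain ⟨s, hs⟩ := IsNoetherian.noetherian a
  refine ⟨s.card, fun i hi q => subsingleton_of_card_lt a s ?_ ?_ hi⟩
  · rw [← hs]
    exact Submodule.subset_span
  · intro p _ hp
    rw [← hs]
    exact Submodule.span_le.2 hp

lemma subsingleton_of_mem_support {M : Type} [AddCommGroup M] [Module R M] [Module.Finite R M]
    {c : ℕ} (hM : ∀ i, c < i → Subsingleton (TopLC R a i M)) (hi : c < i) (q : PrimeSpectrum R)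
    (hq : q ∈ Module.support R M) : Subsingleton (TopLC R a i (R ⧸ q.asIdeal)) := by
  obtain ⟨n, hn⟩ := exists_bound a
  obtain ⟨k, hk⟩ : ∃ k, n < i + k := ⟨n + 1, by omega⟩
  induction k generalizing i q with
  | zero => exact hn i (by omega) q
  | succ k ih =>
    induction q using (InvImage.wf (fun q : PrimeSpectrum R => q.asIdeal)
      (wellFounded_gt (α := Ideal R))).induction with
    | _ q ihq =>
      obtain ⟨f, hf⟩ := exists_ne_zero_hom q hq
      have h1 : Subsingleton (TopLC R a (i + 1) (LinearMap.ker f)) :=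
        subsingleton_of_support a fun p hp => ih (by omega) p
          (Module.support_subset_of_injective (LinearMap.ker f).subtype
            Subtype.val_injective hp) (by omega)
      have h2 : Function.Surjective (map a i f.rangeRestrict) :=
        map_surjective_of_subsingleton a (Subtype.val_injective (p := (· ∈ LinearMap.ker f)))
          f.surjective_rangeRestrict (f := (LinearMap.ker f).subtype)
          (fun x => by simp [Subtype.ext_iff]) h1
      have := hM i hi
      have h3 := h2.subsingleton
      refine subsingleton_of_exact a (f := (LinearMap.range f).subtype)
        (g := (LinearMap.range f).mkQ) Subtype.val_injective (Submodule.mkQ_surjective _)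
        (LinearMap.exact_subtype_mkQ _) h3 (subsingleton_of_support a fun p hp => ?_)
      have hlt := lt_of_mem_support_quotient (mt LinearMap.range_eq_bot.1 hf) hp
      exact ihq p hlt (Module.mem_support_mono hlt.le hq)

end Bounds

end LC

section Attached

variable {R : Type} [CommRing R] {A : Type} [AddCommGroup A] [Module R A]

lemma mem_radical_annihilator_iff {N : Submodule R A} {r : R} :
    r ∈ N.annihilator.radical ↔ ∃ n : ℕ, ∀ m ∈ N, r ^ n • m = 0 := by
  simp only [Ideal.mem_radical_iff, Submodule.mem_annihilator]

lemma IsSecondarySub.sup {N N' : Submodule R A} (hN : IsSecondarySub R N)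
    (hN' : IsSecondarySub R N') (h : N.annihilator.radical = N'.annihilator.radical) :
    IsSecondarySub R (N ⊔ N') := by
  refine ⟨ne_bot_of_le_ne_bot hN.1 le_sup_left, fun r => ?_⟩
  by_cases hr : r ∈ N.annihilator.radical
  · right
    obtain ⟨n, hn⟩ := mem_radical_annihilator_iff.1 hr
    obtain ⟨n', hn'⟩ := mem_radical_annihilator_iff.1 (h ▸ hr)
    refine ⟨n + n', fun m hm => ?_⟩
    obtain ⟨y, hy, z, hz, rfl⟩ := Submodule.mem_sup.1 hm
    rw [smul_add, pow_add, mul_smul, mul_smul, hn' z hz, smul_comm, hn y hy]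
    simp
  · left
    have h1 := (hN.2 r).resolve_right (mt mem_radical_annihilator_iff.2 hr)
    have h2 := (hN'.2 r).resolve_right (mt mem_radical_annihilator_iff.2 (h ▸ hr))
    intro m hm
    obtain ⟨y, hy, z, hz, rfl⟩ := Submodule.mem_sup.1 hm
    obtain ⟨y, hyN, rfl⟩ := h1 y hy
    obtain ⟨z, hzN, rfl⟩ := h2 z hz
    exact ⟨y + z, Submodule.add_mem_sup hyN hzN, smul_add _ _ _⟩

lemma IsRepresentable.exists_isMinimalRep (h : IsRepresentable R A) :
    ∃ (n : ℕ) (S : Fin n → Submodule R A), IsMinimalRep R S := by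
  classical
  have hex : ∃ (k : ℕ) (s : Finset (Submodule R A)), s.card = k ∧
      (∀ N ∈ s, IsSecondarySub R N) ∧ s.sup id = ⊤ := by
    obtain ⟨n, S, hS, htop⟩ := h
    refine ⟨_, Finset.univ.image S, rfl, by simpa using hS, ?_⟩
    rw [Finset.sup_image, ← htop, Finset.sup_univ_eq_iSup]
    rfl
  obtain ⟨s, hk, hs, htop⟩ := Nat.find_spec hex
  have hmin : ∀ t : Finset (Submodule R A), (∀ N ∈ t, IsSecondarySub R N) → t.sup id = ⊤ →
      s.card ≤ t.card := fun t ht ht' => hk ▸ Nat.find_min' hex ⟨t, rfl, ht, ht'⟩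
  let S : Fin s.card → Submodule R A := fun i => (s.equivFin.symm i : Submodule R A)
  have hSs : ∀ i, S i ∈ s := fun i => (s.equivFin.symm i).2
  have hSinj : Function.Injective S := Subtype.val_injective.comp s.equivFin.symm.injective
  have hSsurj : ∀ N ∈ s, ∃ i, S i = N := fun N hN =>
    ⟨s.equivFin ⟨N, hN⟩, by simp [S]⟩
  have hle : ∀ t : Finset (Submodule R A), (∀ N ∈ s, N ≤ t.sup id) → t.sup id = ⊤ := fun t ht =>
    top_le_iff.1 (htop ▸ Finset.sup_le ht)
  refine ⟨s.card, S, fun i => hs _ (hSs i), ?_, ?_, ?_⟩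
  · rw [eq_top_iff, ← htop]
    refine Finset.sup_le fun N hN => ?_
    obtain ⟨i, rfl⟩ := hSsurj N hN
    exact le_iSup S i
  · intro i j hij
    by_contra hne
    have hSne : S i ≠ S j := fun h => hne (hSinj h)
    let t := insert (S i ⊔ S j) ((s.erase (S i)).erase (S j))
    have hsup : S i ⊔ S j ≤ t.sup id := Finset.le_sup (f := id) (Finset.mem_insert_self _ _)
    have h1 := hmin t
      (by
        intro N hN
        rcases Finset.mem_insert.1 hN with rfl | hN
        · exact (hs _ (hSs i)).sup (hs _ (hSs j)) hij
        · exact hs N (Finset.mem_of_mem_erase (Finset.mem_of_mem_erase hN)))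
      (hle t fun N hN => by
        by_cases hi : N = S i
        · exact hi ▸ le_sup_left.trans hsup
        by_cases hj : N = S j
        · exact hj ▸ le_sup_right.trans hsup
        exact Finset.le_sup (f := id) (Finset.mem_insert_of_mem
          (Finset.mem_erase.2 ⟨hj, Finset.mem_erase.2 ⟨hi, hN⟩⟩)))
    have h2 := Finset.card_erase_lt_of_mem (hSs i)
    have h3 := Finset.card_erase_lt_of_mem (Finset.mem_erase.2 ⟨hSne.symm, hSs j⟩)
    have h4 : t.card ≤ _ := Finset.card_insert_le _ _
    omega
  · intro j hj
    refine (Finset.card_erase_lt_of_mem (hSs j)).not_ge (hmin _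
      (fun N hN => hs N (Finset.mem_of_mem_erase hN)) (hle _ ?_))
    have hi : ∀ i, i ≠ j → S i ≤ (s.erase (S j)).sup id := fun i hij =>
      Finset.le_sup (f := id) (Finset.mem_erase.2 ⟨hSinj.ne hij, hSs i⟩)
    intro N hN
    obtain ⟨i, rfl⟩ := hSsurj N hN
    by_cases hij : i = j
    · subst hij
      exact hj.trans (iSup₂_le hi)
    · exact hi i hij

/-- Nonzero images of a representable module which are `p`-secondary give attached primes. -/
lemma mem_attachedPrimes_of_surjective (h : IsRepresentable R A) {H : Type} [AddCommGroup H]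
    [Module R H] [Nontrivial H] {F : A →ₗ[R] H} (hF : Function.Surjective F) {p : Ideal R}
    [p.IsPrime] (hp : ∀ x ∈ p, ∀ y : H, x • y = 0)
    (hp' : ∀ x ∉ p, Function.Surjective fun y : H => x • y) : p ∈ AttachedPrimes R A := by
  obtain ⟨n, S, hS⟩ := h.exists_isMinimalRep
  refine ⟨n, S, hS, ?_⟩
  by_contra! hne
  have hkill : ∀ i, ∃ y ∉ p, ∀ m ∈ S i, y • F m = 0 := by
    intro i
    by_cases hi : (S i).annihilator.radical ≤ p
    · obtain ⟨x, hxp, hx⟩ := Set.not_subset.1 fun hpi : p ≤ _ => hne i (le_antisymm hpi hi)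
      refine ⟨1, (Ideal.ne_top_iff_one p).1 (Ideal.IsPrime.ne_top ‹_›), fun m hm => ?_⟩
      obtain ⟨m, -, rfl⟩ := ((hS.1 i).2 x).resolve_right
        (mt mem_radical_annihilator_iff.2 hx) m hm
      rw [map_smul, hp x hxp, smul_zero]
    · obtain ⟨x, hx, hxp⟩ := Set.not_subset.1 hi
      obtain ⟨k, hk⟩ := mem_radical_annihilator_iff.1 hx
      refine ⟨x ^ k, fun hxk => hxp (Ideal.IsPrime.mem_of_pow_mem ‹_› k hxk), fun m hm => ?_⟩
      rw [← map_smul, hk m hm, map_zero]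
  choose y hyp hy using hkill
  have hprod : ∏ i, y i ∉ p := by
    rw [Ideal.IsPrime.prod_mem_iff]
    rintro ⟨i, -, hi⟩
    exact hyp i hi
  have hzero : ∀ m, (∏ i, y i) • F m = 0 := by
    have htop : ⨆ i, S i ≤ LinearMap.ker ((∏ i, y i) • F) := by
      refine iSup_le fun i m hm => ?_
      rw [LinearMap.mem_ker, LinearMap.smul_apply, ← Finset.prod_erase_mul _ _ (Finset.mem_univ i),
        mul_smul, hy i m hm, smul_zero]
    rw [hS.2.1] at htop
    exact fun m => htop (Submodule.mem_top (x := m))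
  obtain ⟨w, hw⟩ := exists_ne (0 : H)
  obtain ⟨z, rfl⟩ := hp' _ hprod w
  obtain ⟨m, rfl⟩ := hF z
  exact hw (hzero m)

end Attached

section CohDim

variable {R : Type} [CommRing R] {a : Ideal R} {N : Type} [AddCommGroup N] [Module R N] {c : ℕ}

lemma subsingleton_of_cohDim_eq (h : cohDim R a N = (c : WithBot ℕ∞)) {i : ℕ} (hi : c < i) :
    Subsingleton (TopLC R a i N) := by
  by_contra hn
  have h1 : ((i : ℕ) : WithBot ℕ∞) ≤ cohDim R a N :=
    le_sSup ⟨i, rfl, not_subsingleton_iff_nontrivial.1 hn⟩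
  rw [h] at h1
  exact hi.not_ge (by exact_mod_cast h1)

lemma nontrivial_of_cohDim_eq (h : cohDim R a N = (c : WithBot ℕ∞)) :
    Nontrivial (TopLC R a c N) := by
  by_contra hn
  have h1 : ∀ i, Nontrivial (TopLC R a i N) → i < c := by
    intro i hi
    refine lt_of_le_of_ne (not_lt.1 fun hci => ?_) ?_
    · exact not_nontrivial_iff_subsingleton.2 (subsingleton_of_cohDim_eq h hci) hi
    · rintro rfl
      exact hn hi
  cases c with
  | zero =>
    have : cohDim R a N ≤ ⊥ := sSup_le fun b ⟨i, _, hi⟩ => absurd (h1 i hi) (Nat.not_lt_zero i)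
    rw [h, le_bot_iff] at this
    exact WithBot.coe_ne_bot this
  | succ k =>
    have : cohDim R a N ≤ (k : ℕ) := by
      refine sSup_le ?_
      rintro b ⟨i, rfl, hi⟩
      exact_mod_cast Nat.lt_succ_iff.1 (h1 i hi)
    rw [h] at this
    exact absurd (show k + 1 ≤ k by exact_mod_cast this) (by omega)

end CohDim

/-- Under the support, dimension and cohomological dimension conditions, `p` is attached. -/
theorem LC.mem_attachedPrimes {R : Type} [CommRing R] [IsNoetherianRing R] (a : Ideal R)
    {M : Type} [AddCommGroup M] [Module R M] [Module.Finite R M] {c : ℕ}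
    (hc : cohDim R a M = (c : WithBot ℕ∞)) (hrep : IsRepresentable R (TopLC R a c M))
    {p : PrimeSpectrum R} (hp : p ∈ Module.support R M)
    (hdim : ringKrullDim (R ⧸ p.asIdeal) = (c : WithBot ℕ∞))
    (hcd : cohDim R a (R ⧸ p.asIdeal) = (c : WithBot ℕ∞)) :
    p.asIdeal ∈ AttachedPrimes R (TopLC R a c M) := by
  have hM : ∀ i, c < i → Subsingleton (TopLC R a i M) := fun i hi => subsingleton_of_cohDim_eq hc hi
  have hlt : ∀ q, p < q → Subsingleton (TopLC R a c (R ⧸ q.asIdeal)) := fun q hq =>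
    subsingleton_of_ringKrullDim_lt a
      (ringKrullDim_quotient_lt hq (hdim.trans_lt (by exact_mod_cast c.lt_succ_self))) le_rfl
  obtain ⟨f, hf⟩ := exists_ne_zero_hom p hp
  have hJ : LinearMap.range f ≠ ⊥ := mt LinearMap.range_eq_bot.1 hf
  have hker : Subsingleton (TopLC R a (c + 1) (LinearMap.ker f)) :=
    subsingleton_of_support a fun q hq =>
      subsingleton_of_mem_support a hM c.lt_succ_self q
        (Module.support_subset_of_injective (LinearMap.ker f).subtype Subtype.val_injective hq)
  have hF : Function.Surjective (map a c f.rangeRestrict) :=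
    map_surjective_of_subsingleton a (Subtype.val_injective (p := (· ∈ LinearMap.ker f)))
      f.surjective_rangeRestrict (f := (LinearMap.ker f).subtype)
      (fun x => by simp [Subtype.ext_iff]) hker
  have hcoker : Subsingleton (TopLC R a c ((R ⧸ p.asIdeal) ⧸ LinearMap.range f)) :=
    subsingleton_of_support a fun q hq => hlt q (lt_of_mem_support_quotient hJ hq)
  have hH : Nontrivial (TopLC R a c (LinearMap.range f)) := by
    have := nontrivial_of_cohDim_eq hcd
    by_contra hn
    have := not_nontrivial_iff_subsingleton.1 hn
    exact not_subsingleton (TopLC R a c (R ⧸ p.asIdeal)) (subsingleton_of_exact a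
      (f := (LinearMap.range f).subtype) (g := (LinearMap.range f).mkQ) Subtype.val_injective
      (Submodule.mkQ_surjective _) (LinearMap.exact_subtype_mkQ _) this hcoker)
  have hpR : ∀ x ∈ p.asIdeal, ∀ y : R ⧸ p.asIdeal, x • y = 0 := by
    intro x hx y
    rw [Algebra.smul_def, Ideal.Quotient.algebraMap_eq, Ideal.Quotient.eq_zero_iff_mem.2 hx,
      zero_mul]
  refine mem_attachedPrimes_of_surjective hrep hF (fun x hx y => ?_) (fun x hx y => ?_)
  · have h0 : LinearMap.lsmul R (LinearMap.range f) x = 0 :=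
      LinearMap.ext fun z => Subtype.ext (hpR x hx z)
    rw [← map_lsmul, h0, LC.map_zero]
  · let L := LinearMap.lsmul R (LinearMap.range f) x
    have hL : Function.Injective L := fun u v huv =>
      Subtype.ext (lsmul_injective hx (congrArg Subtype.val huv))
    have hQ : Subsingleton (TopLC R a c (LinearMap.range f ⧸ LinearMap.range L)) := by
      refine subsingleton_of_support a fun q hq => hlt q ?_
      have hann := Module.annihilator_le_of_mem_support hq
      refine lt_of_le_of_ne (fun r hr => hann (Module.mem_annihilator.2 fun m => ?_)) ?_
      · obtain ⟨m, rfl⟩ := Submodule.mkQ_surjective _ m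
        have h0 : r • m = 0 := Subtype.ext (hpR r hr m)
        rw [← _root_.map_smul, h0, _root_.map_zero]
      · rintro rfl
        refine hx (hann (Module.mem_annihilator.2 fun m => ?_))
        obtain ⟨m, rfl⟩ := Submodule.mkQ_surjective _ m
        rw [← _root_.map_smul, Submodule.mkQ_apply, Submodule.Quotient.mk_eq_zero]
        exact ⟨m, rfl⟩
    obtain ⟨z, hz⟩ := exists_map_eq_of_map_eq_zero a hL (Submodule.mkQ_surjective _)
      (LinearMap.exact_map_mkQ_range L) y (Subsingleton.elim _ _)
    exact ⟨z, (map_lsmul a x z).symm.trans hz⟩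

/-- Let `c := cd_R(a, M) ≠ -∞` for a finitely generated module `M`, let
`W = { p ∈ Supp_R M : dim R/p = cd_R(a, R/p) = c }` and `X = W ∩ Ass_R M`. If `H^c_a(M)`
is representable, then `X ⊆ Att_R H^c_a(M)`. -/
theorem stmt_12 (R : Type) [CommRing R] [IsNoetherianRing R] (a : Ideal R)
    (M : Type) [AddCommGroup M] [Module R M] [Module.Finite R M]
    (c : ℕ) (hc : cohDim R a M = (c : WithBot ℕ∞))
    (W : Set (PrimeSpectrum R))
    (hW : W = { p ∈ Module.support R M |
      ringKrullDim (R ⧸ p.asIdeal) = (c : WithBot ℕ∞) ∧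
      cohDim R a (R ⧸ p.asIdeal) = (c : WithBot ℕ∞) })
    (X : Set (PrimeSpectrum R)) (hX : X = { p ∈ W | p.asIdeal ∈ associatedPrimes R M })
    (hrep : IsRepresentable R (TopLC R a c M)) :
    ∀ p ∈ X, p.asIdeal ∈ AttachedPrimes R (TopLC R a c M) := by
  subst hW
  subst hX
  rintro p ⟨⟨hp, hdim, hcd⟩, -⟩
  exact LC.mem_attachedPrimes a hc hrep hp hdim hcd
end

section
/- Let R be a commutative Noetherian ring, a an ideal of R, and M a finitely generated R-module with c := cd_R(a, M) ≠ −∞ such that H^c_a(M) is representable. If p ∈ Att_R H^c_a(M) satisfies dim R/p = c, then cd_R(a, R/p) = c (so p lies in the set W of primes q ∈ Supp_R M with dim R/q = cd_R(a, R/q) = c). -/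
/- Common definitions: local cohomology modules, cohomological dimension, module dimension,
secondary representations and attached primes. -/

open CategoryTheory TensorProduct

open Opposite

section CocycleClasses

variable {R : Type} [CommRing R]

/-- The linear map sending a cocycle of a short complex of modules to its homology class. -/
noncomputable def cocycleClass (S : ShortComplex (ModuleCat.{0} R)) :
    LinearMap.ker S.g.hom →ₗ[R] S.homology :=
  (S.moduleCatCyclesIso.inv ≫ S.homologyπ).hom

lemma cocycleClass_surjective (S : ShortComplex (ModuleCat.{0} R)) :
    Function.Surjective (cocycleClass S) :=
  (ModuleCat.epi_iff_surjective (S.moduleCatCyclesIso.inv ≫ S.homologyπ)).1 inferInstance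

lemma cocycleClass_eq_zero_iff (S : ShortComplex (ModuleCat.{0} R))
    (z : LinearMap.ker S.g.hom) : cocycleClass S z = 0 ↔ ∃ y, S.f.hom y = z := by
  have h : cocycleClass S =
      (S.moduleCatLeftHomologyData.π ≫ S.moduleCatHomologyIso.inv).hom := by
    rw [cocycleClass, ShortComplex.moduleCatCyclesIso_inv_π]
  rw [h]
  have h1 : ∀ x : S.moduleCatLeftHomologyData.H,
      S.moduleCatHomologyIso.inv.hom x = 0 ↔ x = 0 := fun x ↦
    map_eq_zero_iff _ ((ModuleCat.mono_iff_injective S.moduleCatHomologyIso.inv).1 inferInstance)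
  refine (h1 _).trans ((Submodule.Quotient.mk_eq_zero _).trans ?_)
  constructor
  · rintro ⟨y, hy⟩
    exact ⟨y, congrArg Subtype.val hy⟩
  · rintro ⟨y, hy⟩
    exact ⟨y, Subtype.ext hy⟩

lemma homologyMap_cocycleClass {S T : ShortComplex (ModuleCat.{0} R)} (φ : S ⟶ T)
    (z : LinearMap.ker S.g.hom) (w : LinearMap.ker T.g.hom) (h : φ.τ₂.hom z = w) :
    (ShortComplex.homologyMap φ).hom (cocycleClass S z) = cocycleClass T w := by
  have hc : (ShortComplex.cyclesMap φ).hom (S.moduleCatCyclesIso.inv.hom z) =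
      T.moduleCatCyclesIso.inv.hom w := by
    apply (ModuleCat.mono_iff_injective T.iCycles).1 inferInstance
    have h1 := congr($(ShortComplex.cyclesMap_i φ).hom (S.moduleCatCyclesIso.inv.hom z))
    have h2 := congr($(S.moduleCatCyclesIso_inv_iCycles).hom z)
    have h3 := congr($(T.moduleCatCyclesIso_inv_iCycles).hom w)
    simp only [ModuleCat.hom_comp, LinearMap.comp_apply] at h1 h2 h3
    exact h1.trans (((congrArg φ.τ₂.hom h2).trans h).trans h3.symm)
  have h4 := congr($(ShortComplex.homologyπ_naturality φ).hom (S.moduleCatCyclesIso.inv.hom z))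
  exact h4.trans (congrArg T.homologyπ.hom hc)

end CocycleClasses

section ExtCocycles

lemma comp_conj_eq {V : Type*} [Category* V] {A B C A' B' D : V} {b : A ⟶ B} {i : B ⟶ C}
    {j : C ⟶ B} {u : B ⟶ B'} {h : A ⟶ A'} {b' : A' ⟶ B'} (hij : i ≫ j = 𝟙 B)
    (hb : b ≫ u = h ≫ b') (k : B' ⟶ D) : (b ≫ i) ≫ (j ≫ u) ≫ k = h ≫ b' ≫ k := by
  rw [Category.assoc, Category.assoc, reassoc_of% hij, reassoc_of% hb]

lemma comp_square_eq {V : Type*} [Category* V] {A B C A' B' C' : V} {b : A ⟶ B} {i : B ⟶ C}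
    {i' : B' ⟶ C'} {v : C ⟶ C'} {u : B ⟶ B'} {h : A ⟶ A'} {b' : A' ⟶ B'}
    (hi : i ≫ v = u ≫ i') (hb : b ≫ u = h ≫ b') : (b ≫ i) ≫ v = h ≫ b' ≫ i' := by
  rw [Category.assoc, hi, reassoc_of% hb]

lemma homologyUnop_hom_naturality {V : Type*} [Category* V] [Abelian V]
    {ι : Type*} {c : ComplexShape ι} {K L : HomologicalComplex Vᵒᵖ c} (f : K ⟶ L) (i : ι) :
    (L.homologyUnop i).hom ≫ (HomologicalComplex.homologyMap f i).unop =
      HomologicalComplex.homologyMap ((HomologicalComplex.unopFunctor V c).map f.op) i ≫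
        (K.homologyUnop i).hom := by
  apply Quiver.Hom.op_inj
  exact (ShortComplex.homologyOpIso_hom_naturality
    ((HomologicalComplex.shortComplexFunctor V c.symm i).map
      ((HomologicalComplex.unopFunctor V c).map f.op)))

variable {R : Type} [CommRing R] {X X' : ModuleCat.{0} R}

/-- The module of `n`-cocycles of `Hom(P, Y)`. -/
noncomputable abbrev extCocycles (P : ProjectiveResolution X) (Y : ModuleCat.{0} R) (n : ℕ) :
    Submodule R ((P.complex.linearYonedaObj R Y).X n) :=
  LinearMap.ker ((P.complex.linearYonedaObj R Y).sc n).g.hom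

lemma mem_extCocycles (P : ProjectiveResolution X) {Y : ModuleCat.{0} R} {n : ℕ}
    (f : P.complex.X n ⟶ Y) :
    f ∈ extCocycles P Y n ↔ P.complex.d (n + 1) n ≫ f = 0 := by
  change ((P.complex.linearYonedaObj R Y).d n ((ComplexShape.up ℕ).next n)).hom f = 0 ↔ _
  rw [CochainComplex.next]
  rfl

/-- The class of a cocycle in the derived functor `Ext`. -/
noncomputable def extClass (P : ProjectiveResolution X) (Y : ModuleCat.{0} R) (n : ℕ) :
    extCocycles P Y n →ₗ[R] ((_root_.Ext R (ModuleCat.{0} R) n).obj (op X)).obj Y :=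
  (P.isoExt n Y).inv.hom ∘ₗ cocycleClass ((P.complex.linearYonedaObj R Y).sc n)

lemma isoExt_inv_bijective (P : ProjectiveResolution X) (Y : ModuleCat.{0} R) (n : ℕ) :
    Function.Bijective (P.isoExt (R := R) n Y).inv.hom :=
  ConcreteCategory.bijective_of_isIso (P.isoExt (R := R) n Y).inv

lemma extClass_surjective (P : ProjectiveResolution X) (Y : ModuleCat.{0} R) (n : ℕ) :
    Function.Surjective (extClass P Y n) :=
  (isoExt_inv_bijective P Y n).2.comp (cocycleClass_surjective _)

lemma extClass_succ_eq_zero_iff (P : ProjectiveResolution X) (Y : ModuleCat.{0} R) (n : ℕ)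
    (z : extCocycles P Y (n + 1)) :
    extClass P Y (n + 1) z = 0 ↔ ∃ g : P.complex.X n ⟶ Y, P.complex.d (n + 1) n ≫ g = z.1 := by
  refine (map_eq_zero_iff _ (isoExt_inv_bijective P Y (n + 1)).1).trans
    ((cocycleClass_eq_zero_iff ((P.complex.linearYonedaObj R Y).sc (n + 1)) z).trans ?_)
  change (∃ g : (P.complex.linearYonedaObj R Y).X ((ComplexShape.up ℕ).prev (n + 1)),
    ((P.complex.linearYonedaObj R Y).d _ (n + 1)).hom g = z.1) ↔ _
  rw [CochainComplex.prev_nat_succ]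
  rfl

lemma extClass_zero_eq_zero_iff (P : ProjectiveResolution X) (Y : ModuleCat.{0} R)
    (z : extCocycles P Y 0) : extClass P Y 0 z = 0 ↔ z = 0 := by
  refine (map_eq_zero_iff _ (isoExt_inv_bijective P Y 0).1).trans
    ((cocycleClass_eq_zero_iff ((P.complex.linearYonedaObj R Y).sc 0) z).trans ?_)
  have h : ((P.complex.linearYonedaObj R Y).sc 0).f = 0 :=
    (P.complex.linearYonedaObj R Y).shape _ _ (by simp)
  rw [h, Subtype.ext_iff]
  exact ⟨fun ⟨_, hy⟩ ↦ hy.symm, fun hz ↦ ⟨0, hz.symm⟩⟩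

lemma map_extClass (P : ProjectiveResolution X) {Y Y' : ModuleCat.{0} R} (g : Y ⟶ Y') (n : ℕ)
    (z : extCocycles P Y n) (z' : extCocycles P Y' n)
    (h : (show P.complex.X n ⟶ Y from z.1) ≫ g = z'.1) :
    (((_root_.Ext R (ModuleCat.{0} R) n).obj (op X)).map g).hom (extClass P Y n z) =
      extClass P Y' n z' := by
  let α := ((linearYoneda R (ModuleCat.{0} R)).map g).rightOp
  let ψ := (NatTrans.mapHomologicalComplex α (ComplexShape.down ℕ)).app P.complex
  let φ : P.complex.linearYonedaObj R Y ⟶ P.complex.linearYonedaObj R Y' :=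
    (HomologicalComplex.unopFunctor _ _).map ψ.op
  have h1 : (P.isoExt (R := R) n Y).inv ≫ ((_root_.Ext R (ModuleCat.{0} R) n).obj (op X)).map g =
      HomologicalComplex.homologyMap φ n ≫ (P.isoExt (R := R) n Y').inv := by
    have e1 : ((_root_.Ext R (ModuleCat.{0} R) n).obj (op X)).map g =
      ((NatTrans.leftDerived α n).app X).unop := rfl
    rw [e1, P.leftDerived_app_eq α n]
    have e3 := homologyUnop_hom_naturality ψ n
    exact comp_conj_eq (congrArg Quiver.Hom.unop (P.isoLeftDerivedObj
      ((linearYoneda R (ModuleCat.{0} R)).obj Y).rightOp n).inv_hom_id) e3 _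
  have h2 := congr($(h1).hom (cocycleClass _ z))
  refine h2.trans (congrArg (P.isoExt (R := R) n Y').inv.hom ?_)
  exact homologyMap_cocycleClass
    ((HomologicalComplex.shortComplexFunctor _ _ n).map φ) z z' h

lemma extClass_map (P : ProjectiveResolution X) (P' : ProjectiveResolution X')
    (f : X ⟶ X') (φ : P.complex ⟶ P'.complex) (hφ : φ.f 0 ≫ P'.π.f 0 = P.π.f 0 ≫ f)
    {Y : ModuleCat.{0} R} (n : ℕ)
    (z : extCocycles P' Y n) (z' : extCocycles P Y n)
    (h : φ.f n ≫ (show P'.complex.X n ⟶ Y from z.1) = z'.1) :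
    (((_root_.Ext R (ModuleCat.{0} R) n).map f.op).app Y).hom (extClass P' Y n z) =
      extClass P Y n z' := by
  let F := ((linearYoneda R (ModuleCat.{0} R)).obj Y).rightOp
  let ψ : P'.complex.linearYonedaObj R Y ⟶ P.complex.linearYonedaObj R Y :=
    (HomologicalComplex.unopFunctor _ _).map ((F.mapHomologicalComplex _).map φ).op
  have h1 : (P'.isoExt (R := R) n Y).inv ≫ ((_root_.Ext R (ModuleCat.{0} R) n).map f.op).app Y =
      HomologicalComplex.homologyMap ψ n ≫ (P.isoExt (R := R) n Y).inv := by
    have e1 : ((_root_.Ext R (ModuleCat.{0} R) n).map f.op).app Y =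
      ((F.leftDerived n).map f).unop := rfl
    have e2 := ProjectiveResolution.isoLeftDerivedObj_hom_naturality f P P' φ hφ F n
    rw [e1]
    have e3 := homologyUnop_hom_naturality ((F.mapHomologicalComplex _).map φ) n
    exact comp_square_eq (congrArg Quiver.Hom.unop e2) e3
  have h2 := congr($(h1).hom (cocycleClass _ z))
  refine h2.trans (congrArg (P.isoExt (R := R) n Y).inv.hom ?_)
  exact homologyMap_cocycleClass
    ((HomologicalComplex.shortComplexFunctor _ _ n).map ψ) z z' h

end ExtCocycles

section LCClass

open Limits

variable {R : Type} [CommRing R]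

lemma extClass_eq_zero_iff {X : ModuleCat.{0} R} (P : ProjectiveResolution X)
    (Y : ModuleCat.{0} R) (n : ℕ) (z : extCocycles P Y n) :
    extClass P Y n z = 0 ↔ ∃ (j : ℕ) (g : P.complex.X j ⟶ Y), P.complex.d n j ≫ g = z.1 := by
  obtain _ | n := n
  · rw [extClass_zero_eq_zero_iff, Subtype.ext_iff]
    constructor
    · intro h
      exact ⟨0, 0, (comp_zero).trans h.symm⟩
    · rintro ⟨j, g, hg⟩
      rw [P.complex.shape 0 j (by simp), zero_comp] at hg
      exact hg.symm
  · rw [extClass_succ_eq_zero_iff]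
    constructor
    · rintro ⟨g, hg⟩
      exact ⟨n, g, hg⟩
    · rintro ⟨j, g, hg⟩
      by_cases hj : j = n
      · subst hj
        exact ⟨g, hg⟩
      · refine ⟨0, ?_⟩
        rw [P.complex.shape _ j (by simpa using hj), zero_comp] at hg
        rw [comp_zero, hg]

variable (a : Ideal R)

/-- A projective resolution of `R ⧸ a ^ t`. -/
noncomputable def powRes (t : ℕ) : ProjectiveResolution (ModuleCat.of R (R ⧸ a ^ t)) :=
  ProjectiveResolution.of _

/-- The projection `R ⧸ a ^ s → R ⧸ a ^ t`. -/
noncomputable def powProj {t s : ℕ} (h : t ≤ s) :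
    ModuleCat.of R (R ⧸ a ^ s) ⟶ ModuleCat.of R (R ⧸ a ^ t) :=
  ModuleCat.ofHom (Submodule.mapQ _ _ LinearMap.id (Ideal.pow_le_pow_right h))

/-- A lift of the projection `R ⧸ a ^ s → R ⧸ a ^ t` to resolutions. -/
noncomputable def powResMap {t s : ℕ} (h : t ≤ s) :
    (powRes a s).complex ⟶ (powRes a t).complex :=
  ProjectiveResolution.lift (powProj a h) _ _

/-- The map from `Ext` of `R ⧸ a ^ t` to local cohomology. -/
noncomputable def lcOfExt (i t : ℕ) (Y : ModuleCat.{0} R) :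
    ((_root_.Ext R (ModuleCat.{0} R) i).obj (op (ModuleCat.of R (R ⧸ a ^ t)))).obj Y →ₗ[R]
      (localCohomology a i).obj Y :=
  ((colimit.ι (localCohomology.diagram (localCohomology.idealPowersDiagram a) i) (op (op t))).app
    Y).hom

variable {a}

/-- The class in local cohomology of a cocycle with values in `Y`. -/
noncomputable def lcClass {i t : ℕ} {Y : ModuleCat.{0} R} (f : (powRes a t).complex.X i ⟶ Y)
    (hf : (powRes a t).complex.d (i + 1) i ≫ f = 0) : (localCohomology a i).obj Y :=
  lcOfExt a i t Y (extClass (powRes a t) Y i ⟨f, (mem_extCocycles _ f).2 hf⟩)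

lemma lcClass_add {i t : ℕ} {Y : ModuleCat.{0} R} (f g : (powRes a t).complex.X i ⟶ Y)
    (hf : (powRes a t).complex.d (i + 1) i ≫ f = 0)
    (hg : (powRes a t).complex.d (i + 1) i ≫ g = 0)
    (hfg : (powRes a t).complex.d (i + 1) i ≫ (f + g) = 0) :
    lcClass (f + g) hfg = lcClass f hf + lcClass g hg :=
  (lcOfExt a i t Y ∘ₗ extClass (powRes a t) Y i).map_add ⟨f, (mem_extCocycles _ f).2 hf⟩
    ⟨g, (mem_extCocycles _ g).2 hg⟩

lemma lcClass_smul {i t : ℕ} {Y : ModuleCat.{0} R} (r : R) (f : (powRes a t).complex.X i ⟶ Y)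
    (hf : (powRes a t).complex.d (i + 1) i ≫ f = 0)
    (hf' : (powRes a t).complex.d (i + 1) i ≫ (r • f) = 0) :
    lcClass (r • f) hf' = r • lcClass f hf :=
  (lcOfExt a i t Y ∘ₗ extClass (powRes a t) Y i).map_smul r ⟨f, (mem_extCocycles _ f).2 hf⟩

lemma map_lcClass {i t : ℕ} {Y Y' : ModuleCat.{0} R} (g : Y ⟶ Y')
    (f : (powRes a t).complex.X i ⟶ Y) (hf : (powRes a t).complex.d (i + 1) i ≫ f = 0) :
    ((localCohomology a i).map g).hom (lcClass f hf) =
      lcClass (f ≫ g) (by rw [reassoc_of% hf, zero_comp]) := by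
  have h1 := (colimit.ι (localCohomology.diagram (localCohomology.idealPowersDiagram a) i)
    (op (op t))).naturality g
  have h2 := congr($(h1).hom (extClass (powRes a t) Y i ⟨f, (mem_extCocycles _ f).2 hf⟩))
  refine h2.symm.trans (congrArg (lcOfExt a i t Y') ?_)
  exact map_extClass _ g i _ _ rfl

lemma lcClass_comp_powResMap {i t s : ℕ} {Y : ModuleCat.{0} R} (h : t ≤ s)
    (f : (powRes a t).complex.X i ⟶ Y) (hf : (powRes a t).complex.d (i + 1) i ≫ f = 0)
    (hf' : (powRes a s).complex.d (i + 1) i ≫ (powResMap a h).f i ≫ f = 0) :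
    lcClass ((powResMap a h).f i ≫ f) hf' = lcClass f hf := by
  have h1 := colimit.w (localCohomology.diagram (localCohomology.idealPowersDiagram a) i)
    (homOfLE h).op.op
  have h2 := congr(($(h1).app Y).hom (extClass (powRes a t) Y i ⟨f, (mem_extCocycles _ f).2 hf⟩))
  refine (congrArg (lcOfExt a i s Y) ?_).trans h2
  symm
  exact extClass_map (powRes a s) (powRes a t) (powProj a h) (powResMap a h)
    (ProjectiveResolution.lift_commutes_zero _ _ _) i _ _ rfl

lemma exists_lcClass_eq {i : ℕ} {Y : ModuleCat.{0} R} (x : (localCohomology a i).obj Y) :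
    ∃ (t : ℕ) (f : (powRes a t).complex.X i ⟶ Y)
      (hf : (powRes a t).complex.d (i + 1) i ≫ f = 0), lcClass f hf = x := by
  let D := localCohomology.diagram (localCohomology.idealPowersDiagram a) i
  obtain ⟨j, y, hy⟩ := Concrete.isColimit_exists_rep _
    (isColimitOfPreserves ((evaluation _ _).obj Y) (colimit.isColimit D)) x
  obtain ⟨z, rfl⟩ := extClass_surjective (powRes a j.unop.unop) Y i y
  exact ⟨j.unop.unop, z.1, (mem_extCocycles _ _).1 z.2, hy⟩

lemma d_comp_powResMap_comp {t s i : ℕ} (h : t ≤ s) {Y : ModuleCat.{0} R}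
    (f : (powRes a t).complex.X i ⟶ Y) (hf : (powRes a t).complex.d (i + 1) i ≫ f = 0) :
    (powRes a s).complex.d (i + 1) i ≫ (powResMap a h).f i ≫ f = 0 := by
  rw [← (powResMap a h).comm_assoc, hf, comp_zero]

lemma lcClass_eq_zero_iff {i t : ℕ} {Y : ModuleCat.{0} R}
    (f : (powRes a t).complex.X i ⟶ Y) (hf : (powRes a t).complex.d (i + 1) i ≫ f = 0) :
    lcClass f hf = 0 ↔ ∃ (s : ℕ) (h : t ≤ s) (j : ℕ) (g : (powRes a s).complex.X j ⟶ Y),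
      (powRes a s).complex.d i j ≫ g = (powResMap a h).f i ≫ f := by
  constructor
  · intro h0
    let D := localCohomology.diagram (localCohomology.idealPowersDiagram a) i
    have h1 := (Concrete.isColimit_rep_eq_iff_exists _
      (isColimitOfPreserves ((evaluation _ _).obj Y) (colimit.isColimit D))
      (i := op (op t)) (j := op (op t))
      (extClass (powRes a t) Y i ⟨f, (mem_extCocycles _ f).2 hf⟩) 0).1 (h0.trans (map_zero _).symm)
    obtain ⟨k, u, v, huv⟩ := h1
    have h : t ≤ k.unop.unop := leOfHom u.unop.unop
    refine ⟨k.unop.unop, h, ?_⟩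
    refine (extClass_eq_zero_iff (powRes a k.unop.unop) Y i
      ⟨_, (mem_extCocycles _ _).2 (d_comp_powResMap_comp h f hf)⟩).1 ?_
    have h3 := huv.trans (map_zero _)
    refine Eq.trans (Eq.symm ?_) h3
    exact extClass_map (powRes a k.unop.unop) (powRes a t) (powProj a h) (powResMap a h)
      (ProjectiveResolution.lift_commutes_zero _ _ _) i _ _ rfl
  · rintro ⟨s, h, j, g, hg⟩
    rw [← lcClass_comp_powResMap h f hf (d_comp_powResMap_comp h f hf)]
    refine (congrArg (lcOfExt a i s Y) ?_).trans (map_zero _)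
    exact (extClass_eq_zero_iff (powRes a s) Y i
      ⟨_, (mem_extCocycles _ _).2 (d_comp_powResMap_comp h f hf)⟩).2 ⟨j, g, hg⟩

end LCClass

section LCMap

open Limits

variable {R : Type} [CommRing R] {a : Ideal R}

lemma lcClass_eq_zero_of_coboundary {i t j : ℕ} {Y : ModuleCat.{0} R}
    (f : (powRes a t).complex.X i ⟶ Y) (hf : (powRes a t).complex.d (i + 1) i ≫ f = 0)
    (g : (powRes a t).complex.X j ⟶ Y) (hg : (powRes a t).complex.d i j ≫ g = f) :
    lcClass f hf = 0 :=
  (congrArg (lcOfExt a i t Y) ((extClass_eq_zero_iff (powRes a t) Y i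
    ⟨_, (mem_extCocycles _ _).2 hf⟩).2 ⟨j, g, hg⟩)).trans (map_zero _)

lemma lcClass_sub {i t : ℕ} {Y : ModuleCat.{0} R} (f g : (powRes a t).complex.X i ⟶ Y)
    (hf : (powRes a t).complex.d (i + 1) i ≫ f = 0)
    (hg : (powRes a t).complex.d (i + 1) i ≫ g = 0)
    (hfg : (powRes a t).complex.d (i + 1) i ≫ (f - g) = 0) :
    lcClass (f - g) hfg = lcClass f hf - lcClass g hg :=
  (lcOfExt a i t Y ∘ₗ extClass (powRes a t) Y i).map_sub ⟨f, (mem_extCocycles _ f).2 hf⟩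
    ⟨g, (mem_extCocycles _ g).2 hg⟩

lemma lcClass_congr {i t : ℕ} {Y : ModuleCat.{0} R} {f g : (powRes a t).complex.X i ⟶ Y}
    (h : f = g) (hf : (powRes a t).complex.d (i + 1) i ≫ f = 0) :
    lcClass f hf = lcClass g (h ▸ hf) := by
  subst h
  rfl

lemma exists_of_lcClass_succ_eq_zero {i t : ℕ} {Y : ModuleCat.{0} R}
    (f : (powRes a t).complex.X (i + 1) ⟶ Y)
    (hf : (powRes a t).complex.d (i + 1 + 1) (i + 1) ≫ f = 0) (h0 : lcClass f hf = 0) :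
    ∃ (s : ℕ) (h : t ≤ s) (g : (powRes a s).complex.X i ⟶ Y),
      (powRes a s).complex.d (i + 1) i ≫ g = (powResMap a h).f (i + 1) ≫ f := by
  obtain ⟨s, h, j, g, hg⟩ := (lcClass_eq_zero_iff f hf).1 h0
  by_cases hj : j = i
  · subst hj
    exact ⟨s, h, g, hg⟩
  · refine ⟨s, h, 0, ?_⟩
    rw [(powRes a s).complex.shape _ j (by simpa using hj), zero_comp] at hg
    rw [comp_zero, hg]

section Lifting

variable {A B C : ModuleCat.{0} R} {f : A ⟶ B} {g : B ⟶ C}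

lemma exists_comp_eq_of_projective (hg : Function.Surjective g.hom) {P : ModuleCat.{0} R}
    [Projective P] (h : P ⟶ C) : ∃ h' : P ⟶ B, h' ≫ g = h := by
  have : Epi g := (ModuleCat.epi_iff_surjective g).2 hg
  exact ⟨Projective.factorThru h g, Projective.factorThru_comp h g⟩

lemma exists_comp_eq_of_exact (hf : Function.Injective f.hom) (hfg : Function.Exact f.hom g.hom)
    {P : ModuleCat.{0} R} (h : P ⟶ B) (hh : h ≫ g = 0) : ∃ h' : P ⟶ A, h' ≫ f = h := by
  have h1 : ∀ x, h.hom x ∈ LinearMap.range f.hom := fun x ↦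
    (hfg _).1 congr($(hh).hom x)
  refine ⟨ModuleCat.ofHom ((LinearEquiv.ofInjective f.hom hf).symm.toLinearMap ∘ₗ
    h.hom.codRestrict _ h1), ?_⟩
  ext x
  exact congrArg Subtype.val ((LinearEquiv.ofInjective f.hom hf).apply_symm_apply ⟨h.hom x, h1 x⟩)

lemma comp_eq_zero_of_injective (hf : Function.Injective f.hom) {P : ModuleCat.{0} R} {h : P ⟶ A}
    (hh : h ≫ f = 0) : h = 0 := by
  have : Mono f := (ModuleCat.mono_iff_injective f).2 hf
  rwa [← cancel_mono f, zero_comp]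

end Lifting

variable (a) in
/-- The map induced on local cohomology by a linear map. -/
noncomputable def lcMap (i : ℕ) {M N : Type} [AddCommGroup M] [Module R M] [AddCommGroup N]
    [Module R N] (f : M →ₗ[R] N) : TopLC R a i M →ₗ[R] TopLC R a i N :=
  ((localCohomology a i).map (ModuleCat.ofHom f)).hom

instance (t i : ℕ) : Projective ((powRes a t).complex.X i) := (powRes a t).projective i

variable {A B C : Type} [AddCommGroup A] [Module R A] [AddCommGroup B] [Module R B]
  [AddCommGroup C] [Module R C] {f : A →ₗ[R] B} {g : B →ₗ[R] C}

lemma lcMap_lcClass {i t : ℕ} (f : A →ₗ[R] B) (u : (powRes a t).complex.X i ⟶ ModuleCat.of R A)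
    (hu : (powRes a t).complex.d (i + 1) i ≫ u = 0) :
    lcMap a i f (lcClass u hu) =
      lcClass (u ≫ ModuleCat.ofHom f) (by rw [reassoc_of% hu, zero_comp]) :=
  map_lcClass _ _ _

lemma lcMap_id (i : ℕ) : lcMap a i (LinearMap.id : A →ₗ[R] A) = LinearMap.id :=
  congrArg ModuleCat.Hom.hom ((localCohomology a i).map_id (ModuleCat.of R A))

lemma lcMap_comp (i : ℕ) (f : A →ₗ[R] B) (g : B →ₗ[R] C) (x : TopLC R a i A) :
    lcMap a i (g ∘ₗ f) x = lcMap a i g (lcMap a i f x) :=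
  congr(($((localCohomology a i).map_comp (ModuleCat.ofHom f) (ModuleCat.ofHom g))).hom x)

lemma lcMap_add (i : ℕ) (f g : A →ₗ[R] B) (x : TopLC R a i A) :
    lcMap a i (f + g) x = lcMap a i f x + lcMap a i g x := by
  obtain ⟨t, u, hu, rfl⟩ := exists_lcClass_eq x
  rw [lcMap_lcClass, lcMap_lcClass, lcMap_lcClass]
  exact lcClass_add (u ≫ ModuleCat.ofHom f) (u ≫ ModuleCat.ofHom g) _ _ _

lemma lcMap_smul (i : ℕ) (r : R) (f : A →ₗ[R] B) (x : TopLC R a i A) :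
    lcMap a i (r • f) x = r • lcMap a i f x := by
  obtain ⟨t, u, hu, rfl⟩ := exists_lcClass_eq x
  rw [lcMap_lcClass, lcMap_lcClass]
  exact lcClass_smul r (u ≫ ModuleCat.ofHom f) _ _

lemma lcMap_zero (i : ℕ) (x : TopLC R a i A) : lcMap a i (0 : A →ₗ[R] B) x = 0 := by
  have := lcMap_smul i (0 : R) (0 : A →ₗ[R] B) x
  rwa [zero_smul, zero_smul] at this

/-- Local cohomology is exact in the middle. -/
lemma exists_lcMap_eq (hf : Function.Injective f) (hg : Function.Surjective g)
    (hfg : Function.Exact f g) (i : ℕ) (x : TopLC R a i B) (hx : lcMap a i g x = 0) :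
    ∃ y, lcMap a i f y = x := by
  obtain ⟨t, u, hu, rfl⟩ := exists_lcClass_eq x
  rw [lcMap_lcClass] at hx
  obtain ⟨s, h, j, v, hv⟩ := (lcClass_eq_zero_iff _ _).1 hx
  obtain ⟨w, rfl⟩ := exists_comp_eq_of_projective (g := ModuleCat.ofHom g) hg v
  obtain ⟨k, hk⟩ := exists_comp_eq_of_exact (f := ModuleCat.ofHom f) (g := ModuleCat.ofHom g) hf hfg
    ((powResMap a h).f i ≫ u - (powRes a s).complex.d i j ≫ w) (by simp [hv])
  have hd := d_comp_powResMap_comp h u hu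
  have hk0 : (powRes a s).complex.d (i + 1) i ≫ k = 0 := by
    apply comp_eq_zero_of_injective (f := ModuleCat.ofHom f) hf
    rw [Category.assoc, hk, Preadditive.comp_sub, hd]
    simp
  refine ⟨lcClass k hk0, ?_⟩
  rw [lcMap_lcClass, lcClass_congr hk, lcClass_sub _ _ hd (by simp),
    lcClass_eq_zero_of_coboundary _ _ w rfl, sub_zero]
  exact lcClass_comp_powResMap h u hu hd

lemma lcMap_surjective_of_subsingleton (hf : Function.Injective f) (hg : Function.Surjective g)
    (hfg : Function.Exact f g) (i : ℕ) [Subsingleton (TopLC R a (i + 1) A)] :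
    Function.Surjective (lcMap a i g) := by
  intro x
  obtain ⟨t, u, hu, rfl⟩ := exists_lcClass_eq x
  obtain ⟨v, rfl⟩ := exists_comp_eq_of_projective (g := ModuleCat.ofHom g) hg u
  obtain ⟨k, hk⟩ := exists_comp_eq_of_exact (f := ModuleCat.ofHom f) (g := ModuleCat.ofHom g) hf hfg
    ((powRes a t).complex.d (i + 1) i ≫ v) (by simpa using hu)
  have hk0 : (powRes a t).complex.d (i + 1 + 1) (i + 1) ≫ k = 0 := by
    apply comp_eq_zero_of_injective (f := ModuleCat.ofHom f) hf
    rw [Category.assoc, hk]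
    simp
  obtain ⟨s, h, m, hm⟩ := exists_of_lcClass_succ_eq_zero k hk0
    (Subsingleton.elim (α := TopLC R a (i + 1) A) _ _)
  have hc : (powRes a s).complex.d (i + 1) i ≫
      ((powResMap a h).f i ≫ v - m ≫ ModuleCat.ofHom f) = 0 := by
    rw [Preadditive.comp_sub, reassoc_of% hm, hk, ← (powResMap a h).comm_assoc, sub_self]
  refine ⟨lcClass _ hc, ?_⟩
  have h0 : ModuleCat.ofHom f ≫ ModuleCat.ofHom g = 0 := by
    ext x
    exact hfg.apply_apply_eq_zero x
  rw [lcMap_lcClass]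
  refine Eq.trans (lcClass_congr ?_ _)
    (lcClass_comp_powResMap h _ hu (d_comp_powResMap_comp h _ hu))
  rw [Preadditive.sub_comp, Category.assoc, Category.assoc, h0, comp_zero, sub_zero]

lemma lcMap_injective_of_surjective (hf : Function.Injective f) (hg : Function.Surjective g)
    (hfg : Function.Exact f g) (i : ℕ) (hs : Function.Surjective (lcMap a i g)) :
    Function.Injective (lcMap a (i + 1) f) := by
  rw [injective_iff_map_eq_zero]
  intro x hx
  obtain ⟨t, k, hk, rfl⟩ := exists_lcClass_eq x
  rw [lcMap_lcClass] at hx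
  obtain ⟨s, h, v, hv⟩ := exists_of_lcClass_succ_eq_zero _ _ hx
  have h0 : ModuleCat.ofHom f ≫ ModuleCat.ofHom g = 0 := by
    ext x
    exact hfg.apply_apply_eq_zero x
  have hvg : (powRes a s).complex.d (i + 1) i ≫ v ≫ ModuleCat.ofHom g = 0 := by
    rw [reassoc_of% hv, h0, comp_zero, comp_zero]
  obtain ⟨y, hy⟩ := hs (lcClass _ hvg)
  obtain ⟨r, u, hu, rfl⟩ := exists_lcClass_eq y
  rw [lcMap_lcClass] at hy
  have hug : (powRes a r).complex.d (i + 1) i ≫ u ≫ ModuleCat.ofHom g = 0 := by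
    rw [reassoc_of% hu, zero_comp]
  have hu' := d_comp_powResMap_comp (le_max_right s r) u hu
  have e1 := d_comp_powResMap_comp (le_max_left s r) _ hvg
  have e2 := d_comp_powResMap_comp (le_max_right s r) _ hug
  have e3 := lcClass_sub _ _ e1 e2 (by rw [Preadditive.comp_sub, e1, e2, sub_zero])
  rw [lcClass_comp_powResMap _ _ hvg, lcClass_comp_powResMap _ _ hug, hy] at e3
  replace e3 := (lcClass_eq_zero_iff _ _).1 (e3.trans (sub_self _))
  obtain ⟨q, hq, j, m, hm⟩ := e3
  obtain ⟨m', rfl⟩ := exists_comp_eq_of_projective (g := ModuleCat.ofHom g) hg m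
  obtain ⟨l, hl⟩ := exists_comp_eq_of_exact (f := ModuleCat.ofHom f) (g := ModuleCat.ofHom g) hf hfg
    ((powResMap a hq).f i ≫ ((powResMap a (le_max_left s r)).f i ≫ v -
      (powResMap a (le_max_right s r)).f i ≫ u) - (powRes a q).complex.d i j ≫ m') (by
      simpa [sub_eq_zero] using hm.symm)
  have hk1 := d_comp_powResMap_comp h k hk
  have hk2 := d_comp_powResMap_comp (le_max_left s r) _ hk1
  have hk3 := d_comp_powResMap_comp hq _ hk2
  rw [← lcClass_comp_powResMap h k hk hk1, ← lcClass_comp_powResMap _ _ hk1 hk2,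
    ← lcClass_comp_powResMap _ _ hk2 hk3]
  refine lcClass_eq_zero_of_coboundary _ _ l ?_
  rw [← sub_eq_zero]
  apply comp_eq_zero_of_injective (f := ModuleCat.ofHom f) hf
  rw [Preadditive.sub_comp, Category.assoc, hl, sub_eq_zero]
  simp only [Preadditive.comp_sub, HomologicalComplex.d_comp_d_assoc, zero_comp, sub_zero,
    ← (powResMap a hq).comm_assoc, ← (powResMap a (le_max_right s r)).comm_assoc,
    ← (powResMap a (le_max_left s r)).comm_assoc, hu, comp_zero, hv, Category.assoc]

lemma subsingleton_lc_of_injective [Module.Injective R A] (i : ℕ) :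
    Subsingleton (TopLC R a (i + 1) A) := by
  refine subsingleton_of_forall_eq 0 fun x ↦ ?_
  obtain ⟨t, k, hk, rfl⟩ := exists_lcClass_eq x
  have : Injective (ModuleCat.of R A) := Module.injective_object_of_injective_module R A
  exact lcClass_eq_zero_of_coboundary k hk (((powRes a t).exact_succ i).descToInjective k hk)
    (((powRes a t).exact_succ i).comp_descToInjective k hk)

lemma subsingleton_lc_of_subsingleton [Subsingleton A] (i : ℕ) : Subsingleton (TopLC R a i A) := by
  refine subsingleton_of_forall_eq 0 fun x ↦ ?_
  have : (LinearMap.id : A →ₗ[R] A) = 0 := by ext; exact Subsingleton.elim _ _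
  rw [← lcMap_zero (B := A) i x, ← this, lcMap_id, LinearMap.id_apply]

lemma subsingleton_lc_congr (e : A ≃ₗ[R] B) (i : ℕ) [Subsingleton (TopLC R a i A)] :
    Subsingleton (TopLC R a i B) := by
  refine subsingleton_of_forall_eq 0 fun x ↦ ?_
  have h := lcMap_comp i e.symm.toLinearMap e.toLinearMap x
  rwa [Subsingleton.elim (lcMap a i e.symm.toLinearMap x) 0, map_zero, LinearEquiv.comp_symm,
    lcMap_id] at h

lemma subsingleton_lc_middle (hf : Function.Injective f) (hg : Function.Surjective g)
    (hfg : Function.Exact f g) (i : ℕ) [Subsingleton (TopLC R a i A)]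
    [Subsingleton (TopLC R a i C)] : Subsingleton (TopLC R a i B) := by
  refine subsingleton_of_forall_eq 0 fun x ↦ ?_
  obtain ⟨y, rfl⟩ := exists_lcMap_eq hf hg hfg i x (Subsingleton.elim _ _)
  rw [Subsingleton.elim y 0, map_zero]

lemma exists_pow_smul_eq_zero (i : ℕ) (x : TopLC R a i A) :
    ∃ t, ∀ r ∈ a ^ t, r • x = 0 := by
  obtain ⟨t, k, hk, rfl⟩ := exists_lcClass_eq x
  refine ⟨t, fun r hr ↦ ?_⟩
  have h0 : (powRes a t).complex.d (i + 1) i ≫ (0 : _ ⟶ ModuleCat.of R A) = 0 := comp_zero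
  have hk' : (powRes a t).complex.d (i + 1) i ≫ (r • k) = 0 := by
    rw [Linear.comp_smul, hk, smul_zero]
  have hr0 : ∀ y : R ⧸ a ^ t, r • y = 0 := by
    intro y
    obtain ⟨y, rfl⟩ := Ideal.Quotient.mk_surjective y
    rw [← Ideal.Quotient.mk_eq_mk, ← Submodule.Quotient.mk_smul, Submodule.Quotient.mk_eq_zero]
    exact Ideal.mul_mem_right _ _ hr
  have e1 := extClass_map (powRes a t) (powRes a t) 0 (r • 𝟙 _) (by
    ext x
    exact (map_smul ((powRes a t).π.f 0).hom r x).trans (hr0 _)) (Y := ModuleCat.of R A) i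
    ⟨k, (mem_extCocycles _ k).2 hk⟩
    ⟨r • k, (mem_extCocycles _ _).2 hk'⟩ (by simp)
  have e2 := extClass_map (powRes a t) (powRes a t) 0 0 (zero_comp.trans comp_zero.symm)
    (Y := ModuleCat.of R A) i ⟨k, (mem_extCocycles _ k).2 hk⟩ 0 zero_comp
  have e3 := lcClass_smul r k hk hk'
  refine e3.symm.trans ?_
  exact (congrArg (lcOfExt a i t _) (e1.symm.trans (e2.trans (map_zero _)))).trans (map_zero _)

variable (a) in
/-- The augmentation of the resolution of `R ⧸ a ^ t`. -/
noncomputable def powAug (t : ℕ) : (powRes a t).complex.X 0 ⟶ ModuleCat.of R (R ⧸ a ^ t) :=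
  (powRes a t).π.f 0

lemma d_comp_powAug (t : ℕ) : (powRes a t).complex.d 1 0 ≫ powAug a t = 0 :=
  (powRes a t).complex_d_comp_π_f_zero

lemma powResMap_comp_powAug {t s : ℕ} (h : t ≤ s) :
    (powResMap a h).f 0 ≫ powAug a t = powAug a s ≫ powProj a h :=
  ProjectiveResolution.lift_commutes_zero _ _ _

lemma exists_powAug_comp_eq {t : ℕ} {Y : ModuleCat.{0} R} (u : (powRes a t).complex.X 0 ⟶ Y)
    (hu : (powRes a t).complex.d 1 0 ≫ u = 0) : ∃ w, powAug a t ≫ w = u :=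
  ⟨(powRes a t).exact₀.desc u hu, (powRes a t).exact₀.g_desc u hu⟩

lemma lcMap_zero_surjective (hg : Function.Surjective g)
    (hB : ∀ x : B, ∃ t, ∀ r ∈ a ^ t, r • x = 0) : Function.Surjective (lcMap a 0 g) := by
  intro x
  obtain ⟨t, u, hu, rfl⟩ := exists_lcClass_eq x
  obtain ⟨w, rfl⟩ := exists_powAug_comp_eq u hu
  obtain ⟨b, hb⟩ := hg (w.hom (Submodule.Quotient.mk 1))
  obtain ⟨q, hq⟩ := hB b
  have ht := le_max_left t q
  let e : ModuleCat.of R (R ⧸ a ^ max t q) ⟶ ModuleCat.of R B :=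
    ModuleCat.ofHom (Submodule.liftQ (a ^ max t q) (LinearMap.toSpanSingleton R B b) fun r hr ↦
      hq r (Ideal.pow_le_pow_right (le_max_right _ _) hr))
  have he : e ≫ ModuleCat.ofHom g = powProj a ht ≫ w := by
    ext
    exact (congrArg g (one_smul R b)).trans hb
  have hc : (powRes a (max t q)).complex.d 1 0 ≫ powAug a (max t q) ≫ e = 0 := by
    rw [reassoc_of% d_comp_powAug, zero_comp]
  refine ⟨lcClass _ hc, ?_⟩
  rw [lcMap_lcClass]
  refine Eq.trans (lcClass_congr ?_ _) (lcClass_comp_powResMap ht _ hu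
    (d_comp_powResMap_comp _ _ hu))
  rw [Category.assoc, he, ← reassoc_of% (powResMap_comp_powAug ht)]

end LCMap

section PowTorsion

variable {R : Type} [CommRing R]

/-- Every element is killed by a power of `a`. -/
def IsPowTorsion (a : Ideal R) (M : Type) [AddCommGroup M] [Module R M] : Prop :=
  ∀ x : M, ∃ t : ℕ, ∀ r ∈ a ^ t, r • x = 0

/-- The submodule of elements killed by a power of `a`. -/
def powTorsion (a : Ideal R) (M : Type) [AddCommGroup M] [Module R M] : Submodule R M where
  carrier := {x | ∃ t : ℕ, ∀ r ∈ a ^ t, r • x = 0}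
  zero_mem' := ⟨0, fun r _ ↦ smul_zero r⟩
  add_mem' := by
    rintro x y ⟨t, ht⟩ ⟨s, hs⟩
    refine ⟨max t s, fun r hr ↦ ?_⟩
    rw [smul_add, ht r (Ideal.pow_le_pow_right (le_max_left _ _) hr),
      hs r (Ideal.pow_le_pow_right (le_max_right _ _) hr), add_zero]
  smul_mem' := by
    rintro c x ⟨t, ht⟩
    exact ⟨t, fun r hr ↦ by rw [smul_comm, ht r hr, smul_zero]⟩

variable {a : Ideal R} {M N : Type} [AddCommGroup M] [Module R M] [AddCommGroup N] [Module R N]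

lemma isPowTorsion_powTorsion : IsPowTorsion a (powTorsion a M) := by
  rintro ⟨x, t, ht⟩
  exact ⟨t, fun r hr ↦ Subtype.ext (ht r hr)⟩

lemma IsPowTorsion.of_surjective (h : IsPowTorsion a M) (f : M →ₗ[R] N)
    (hf : Function.Surjective f) : IsPowTorsion a N := by
  intro y
  obtain ⟨x, rfl⟩ := hf y
  obtain ⟨t, ht⟩ := h x
  exact ⟨t, fun r hr ↦ by rw [← map_smul, ht r hr, map_zero]⟩

lemma IsPowTorsion.of_injective (h : IsPowTorsion a N) (f : M →ₗ[R] N)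
    (hf : Function.Injective f) : IsPowTorsion a M := by
  intro x
  obtain ⟨t, ht⟩ := h (f x)
  exact ⟨t, fun r hr ↦ hf (by rw [map_smul, ht r hr, map_zero])⟩

lemma IsPowTorsion.sup {b : Ideal R} (h : IsPowTorsion a M) (h' : IsPowTorsion b M) :
    IsPowTorsion (a ⊔ b) M := by
  intro x
  obtain ⟨t, ht⟩ := h x
  obtain ⟨s, hs⟩ := h' x
  refine ⟨t + s, fun r hr ↦ ?_⟩
  obtain ⟨u, hu, v, hv, rfl⟩ := Submodule.mem_sup.1 (Ideal.sup_pow_add_le_pow_sup_pow hr)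
  rw [add_smul, ht u hu, hs v hv, add_zero]

lemma isPowTorsion_of_le_annihilator (h : a ≤ Module.annihilator R M) : IsPowTorsion a M :=
  fun x ↦ ⟨1, fun r hr ↦ Module.mem_annihilator.1 (h (by simpa using hr)) x⟩

/-- The torsion submodule of an injective module over a Noetherian ring is injective. -/
lemma injective_powTorsion [IsNoetherianRing R] [Module.Injective R M] :
    Module.Injective R (powTorsion a M) := by
  apply Module.Baer.injective
  intro I g
  obtain ⟨t, ht⟩ : ∃ t : ℕ, ∀ r ∈ a ^ t, ∀ x : I, r • g x = 0 := by
    obtain ⟨s, hs⟩ := (IsNoetherian.noetherian (⊤ : Submodule R I))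
    choose e he using fun x : I ↦ isPowTorsion_powTorsion (g x)
    refine ⟨s.sup e, fun r hr x ↦ ?_⟩
    have hx : x ∈ Submodule.span R (s : Set I) := hs ▸ Submodule.mem_top
    induction hx using Submodule.span_induction with
    | mem x hx => exact he x r (Ideal.pow_le_pow_right (Finset.le_sup hx) hr)
    | zero => simp
    | add x y _ _ hx hy => rw [map_add, smul_add, hx, hy, add_zero]
    | smul c x _ hx => rw [map_smul, smul_comm, hx, smul_zero]
  obtain ⟨k, hk⟩ := Ideal.exists_pow_inf_eq_pow_smul a (I : Submodule R R)
  have hn := hk (k + t) (Nat.le_add_right _ _)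
  rw [Nat.add_sub_cancel_left] at hn
  have hle : (a ^ (k + t) • ⊤ ⊓ I : Submodule R R) ≤ a ^ t • (I : Submodule R R) :=
    hn.trans_le (Submodule.smul_mono le_rfl inf_le_right)
  have hg0 : ∀ x : I, (x : R) ∈ a ^ (k + t) → g x = 0 := by
    intro x hx
    have h2 : x ∈ a ^ t • (⊤ : Submodule R I) :=
      (Submodule.mem_smul_top_iff _ _ x).2 (hle ⟨by simpa using hx, x.2⟩)
    clear hx
    induction h2 using Submodule.smul_induction_on' with
    | smul r hr y _ => rw [map_smul]; exact ht r hr y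
    | add x _ y _ hx hy => rw [map_add, hx, hy, add_zero]
  let J : Submodule R I := Submodule.comap (Submodule.subtype I) (a ^ (k + t))
  let q : (I ⧸ J) →ₗ[R] R ⧸ a ^ (k + t) :=
    Submodule.mapQ J (a ^ (k + t)) (Submodule.subtype I) le_rfl
  have hq : Function.Injective q := by
    rw [← LinearMap.ker_eq_bot, Submodule.ker_mapQ]
    exact Submodule.mkQ_map_self J
  let g' : (I ⧸ J) →ₗ[R] M :=
    (powTorsion a M).subtype ∘ₗ Submodule.liftQ J g fun x hx ↦ hg0 x hx
  obtain ⟨h, hh⟩ := Module.Injective.out (R := R) q hq g'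
  refine ⟨(h ∘ₗ Submodule.mkQ (a ^ (k + t))).codRestrict _ fun r ↦ ⟨k + t, fun s hs ↦ ?_⟩,
    fun x hx ↦ ?_⟩
  · rw [← map_smul]
    have : Submodule.mkQ (a ^ (k + t)) (s • r) = 0 :=
      (Submodule.Quotient.mk_eq_zero _).2 (Ideal.mul_mem_right r _ hs)
    rw [LinearMap.comp_apply, this, map_zero]
  · exact Subtype.ext (hh (Submodule.Quotient.mk ⟨x, hx⟩))

end PowTorsion

section Vanishing

variable {R : Type} [CommRing R] {a : Ideal R}

lemma exists_injective_embedding (T : Type) [AddCommGroup T] [Module R T] :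
    ∃ (E : Type) (_ : AddCommGroup E) (_ : Module R E) (_ : Module.Injective R E)
      (f : T →ₗ[R] E), Function.Injective f := by
  let E := Injective.under (ModuleCat.of R T)
  have : Module.Injective R E :=
    (Module.injective_iff_injective_object R E).2 (Injective.injective_under (ModuleCat.of R T))
  exact ⟨E, inferInstance, inferInstance, this, (Injective.ι (ModuleCat.of R T)).hom,
    (ModuleCat.mono_iff_injective _).1 inferInstance⟩

lemma IsPowTorsion.exists_injective_embedding [IsNoetherianRing R] {T : Type} [AddCommGroup T]
    [Module R T] (hT : IsPowTorsion a T) :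
    ∃ (E : Type) (_ : AddCommGroup E) (_ : Module R E) (_ : Module.Injective R E)
      (f : T →ₗ[R] E), Function.Injective f ∧ IsPowTorsion a E := by
  obtain ⟨E, _, _, _, f, hf⟩ := _root_.exists_injective_embedding (R := R) T
  refine ⟨powTorsion a E, inferInstance, inferInstance, injective_powTorsion,
    f.codRestrict _ fun x ↦ ?_, fun x y h ↦ hf (congrArg Subtype.val h), isPowTorsion_powTorsion⟩
  obtain ⟨t, ht⟩ := hT x
  exact ⟨t, fun r hr ↦ by rw [← map_smul, ht r hr, map_zero]⟩

lemma IsPowTorsion.subsingleton_lc [IsNoetherianRing R] (i : ℕ) :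
    ∀ {T : Type} [AddCommGroup T] [Module R T], IsPowTorsion a T →
      Subsingleton (TopLC R a (i + 1) T) := by
  induction i with
  | zero =>
    intro T _ _ hT
    obtain ⟨E, _, _, _, f, hf, hE⟩ := hT.exists_injective_embedding
    have := subsingleton_lc_of_injective (a := a) (A := E) 0
    exact (lcMap_injective_of_surjective (a := a) hf (Submodule.mkQ_surjective _)
      (LinearMap.exact_map_mkQ_range f) 0
      (lcMap_zero_surjective (Submodule.mkQ_surjective _) hE)).subsingleton
  | succ i ih =>
    intro T _ _ hT
    obtain ⟨E, _, _, _, f, hf, hE⟩ := hT.exists_injective_embedding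
    have := subsingleton_lc_of_injective (a := a) (A := E) (i + 1)
    have := ih (hE.of_surjective f.range.mkQ (Submodule.mkQ_surjective _))
    exact (lcMap_injective_of_surjective (a := a) hf (Submodule.mkQ_surjective _)
      (LinearMap.exact_map_mkQ_range f) (i + 1)
      (Function.surjective_to_subsingleton _)).subsingleton

lemma mem_annihilator_quotient_range_smul {T : Type} [AddCommGroup T] [Module R T] (x : R) :
    x ∈ Module.annihilator R (T ⧸ LinearMap.range (x • LinearMap.id : T →ₗ[R] T)) := by
  rw [Module.mem_annihilator]
  intro y
  obtain ⟨y, rfl⟩ := Submodule.mkQ_surjective _ y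
  rw [← map_smul]
  exact (Submodule.Quotient.mk_eq_zero _).2 ⟨y, rfl⟩

/-- Multiplication by an element of `a` is locally nilpotent on local cohomology, so it can only be
injective on zero modules. -/
lemma subsingleton_lc_succ_of_smul_injective {x : R} (hx : x ∈ a) {T : Type} [AddCommGroup T]
    [Module R T] (hinj : Function.Injective (x • LinearMap.id : T →ₗ[R] T)) (i : ℕ)
    [Subsingleton (TopLC R a i (T ⧸ LinearMap.range (x • LinearMap.id : T →ₗ[R] T)))] :
    Subsingleton (TopLC R a (i + 1) T) := by
  have h := lcMap_injective_of_surjective (a := a) hinj (Submodule.mkQ_surjective _)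
    (LinearMap.exact_map_mkQ_range _) i (Function.surjective_to_subsingleton _)
  have h0 : ∀ (t : ℕ) (y : TopLC R a (i + 1) T), x ^ t • y = 0 → y = 0 := by
    intro t
    induction t with
    | zero => intro y hy; simpa using hy
    | succ t ih =>
      intro y hy
      refine ih y (h ?_)
      rw [lcMap_smul, lcMap_id, map_zero, LinearMap.id_apply, smul_smul, ← pow_succ', hy]
  refine subsingleton_of_forall_eq 0 fun y ↦ ?_
  obtain ⟨t, ht⟩ := exists_pow_smul_eq_zero _ y
  exact h0 t y (ht _ (Ideal.pow_mem_pow hx t))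

/-- Local cohomology vanishes above the number of generators, relatively to a torsion module. -/
lemma subsingleton_lc_of_card_lt [IsNoetherianRing R] (s : Finset R) :
    ∀ (b : Ideal R), a = b ⊔ Ideal.span s → ∀ {T : Type} [AddCommGroup T] [Module R T],
      IsPowTorsion b T → ∀ i, s.card < i → Subsingleton (TopLC R a i T) := by
  classical
  induction s using Finset.induction with
  | empty =>
    intro b hb T _ _ hT i hi
    obtain ⟨i, rfl⟩ := Nat.exists_eq_succ_of_ne_zero (Nat.pos_iff_ne_zero.1 hi)
    obtain rfl : a = b := by simpa using hb
    exact hT.subsingleton_lc i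
  | insert x s hxs ih =>
    intro b hb T _ _ hT i hi
    rw [Finset.card_insert_of_notMem hxs] at hi
    have hab : a = (b ⊔ Ideal.span {x}) ⊔ Ideal.span s := by
      rw [hb, Finset.coe_insert, Ideal.span_insert, sup_assoc]
    have hxa : x ∈ a := by
      rw [hab]
      exact Ideal.mem_sup_left (Ideal.mem_sup_right (Ideal.mem_span_singleton_self x))
    have ih' := fun {T : Type} [AddCommGroup T] [Module R T] (h : IsPowTorsion b T)
      (h' : IsPowTorsion (Ideal.span {x}) T) ↦ ih _ hab (h.sup h')
    let P := powTorsion (Ideal.span {x}) T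
    have hP : Subsingleton (TopLC R a i P) :=
      ih' (hT.of_injective P.subtype P.subtype_injective) isPowTorsion_powTorsion i (by omega)
    obtain ⟨i, rfl⟩ : ∃ k, i = k + 1 := ⟨i - 1, by omega⟩
    have hQ : Subsingleton (TopLC R a (i + 1) (T ⧸ P)) := by
      have hTP := hT.of_surjective P.mkQ P.mkQ_surjective
      have : Subsingleton (TopLC R a i
          ((T ⧸ P) ⧸ LinearMap.range (x • LinearMap.id : (T ⧸ P) →ₗ[R] (T ⧸ P)))) := by
        refine ih' (hTP.of_surjective _ (Submodule.mkQ_surjective _))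
          (isPowTorsion_of_le_annihilator ?_) i (by omega)
        exact (Ideal.span_singleton_le_iff_mem _).2 (mem_annihilator_quotient_range_smul x)
      refine subsingleton_lc_succ_of_smul_injective hxa ?_ i
      rw [injective_iff_map_eq_zero]
      intro y hy
      obtain ⟨y, rfl⟩ := P.mkQ_surjective y
      have hy' : x • y ∈ P := (Submodule.Quotient.mk_eq_zero P).1 hy
      obtain ⟨t, ht⟩ := hy'
      refine (Submodule.Quotient.mk_eq_zero P).2 ⟨t + 1, fun r hr ↦ ?_⟩
      rw [Ideal.span_singleton_pow, Ideal.mem_span_singleton'] at hr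
      obtain ⟨r, rfl⟩ := hr
      rw [pow_succ, ← mul_assoc, mul_smul]
      exact ht _ (Ideal.mul_mem_left _ _ (Ideal.pow_mem_pow (Ideal.mem_span_singleton_self x) t))
    exact subsingleton_lc_middle P.subtype_injective P.mkQ_surjective
      (LinearMap.exact_subtype_mkQ P) (i + 1)

end Vanishing

section Finite

variable {R : Type} [CommRing R] {a : Ideal R}

lemma sup_span_le_annihilator_quotient {J : Ideal R} {T : Type} [AddCommGroup T] [Module R T]
    (h : J ≤ Module.annihilator R T) (x : R) :
    J ⊔ Ideal.span {x} ≤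
      Module.annihilator R (T ⧸ LinearMap.range (x • LinearMap.id : T →ₗ[R] T)) := by
  exact sup_le (h.trans (LinearMap.annihilator_le_of_surjective _ (Submodule.mkQ_surjective _)))
    ((Ideal.span_singleton_le_iff_mem _).2 (mem_annihilator_quotient_range_smul x))

lemma ringKrullDim_quotient_sup_span_lt {q : Ideal R} [q.IsPrime] {x : R} (hx : x ∉ q) {d : ℕ}
    (h : ringKrullDim (R ⧸ q) < (d + 1 : ℕ)) :
    ringKrullDim (R ⧸ q ⊔ Ideal.span {x}) < d := by
  have h1 := ringKrullDim_quotient_succ_le_of_nonZeroDivisor (r := Ideal.Quotient.mk q x)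
    (mem_nonZeroDivisors_of_ne_zero fun h ↦ hx (Ideal.Quotient.eq_zero_iff_mem.1 h))
  have h2 := ringKrullDim_eq_of_ringEquiv (DoubleQuot.quotQuotEquivQuotSup q (Ideal.span {x}))
  rw [Ideal.map_span, Set.image_singleton] at h2
  rw [h2] at h1
  by_contra! h3
  refine (h1.trans_lt h).not_ge ?_
  push_cast
  gcongr

variable [IsNoetherianRing R]

lemma subsingleton_lc_of_forall_prime {J : Ideal R} {i : ℕ}
    (h : ∀ q : Ideal R, q.IsPrime → J ≤ q → Subsingleton (TopLC R a i (R ⧸ q)))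
    {N : Type} [AddCommGroup N] [Module R N] [Module.Finite R N]
    (hN : J ≤ Module.annihilator R N) : Subsingleton (TopLC R a i N) := by
  refine IsNoetherianRing.induction_on_isQuotientEquivQuotientPrime R
    (motive := fun N _ _ _ ↦ J ≤ Module.annihilator R N → Subsingleton (TopLC R a i N))
    (inferInstanceAs (Module.Finite R N)) ?_ ?_ ?_ hN
  · intro N _ _ _ _ _
    exact subsingleton_lc_of_subsingleton i
  · intro N _ _ _ q e hq
    rw [e.annihilator_eq, Ideal.annihilator_quotient] at hq
    have := h _ q.2 hq
    exact subsingleton_lc_congr e.symm i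
  · intro A _ _ _ B _ _ _ C _ _ _ f g hf hg hfg hA hC hB
    have := hA (hB.trans (LinearMap.annihilator_le_of_injective f hf))
    have := hC (hB.trans (LinearMap.annihilator_le_of_surjective g hg))
    exact subsingleton_lc_middle hf hg hfg i

/-- Grothendieck's vanishing theorem. -/
lemma subsingleton_lc_of_ringKrullDim_lt (d : ℕ) :
    ∀ (J : Ideal R), ringKrullDim (R ⧸ J) < d → ∀ {N : Type} [AddCommGroup N] [Module R N]
      [Module.Finite R N], J ≤ Module.annihilator R N → ∀ i, d ≤ i →
      Subsingleton (TopLC R a i N) := by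
  induction d with
  | zero =>
    intro J hJ N _ _ _ hN i _
    have hJ' : J = ⊤ := by
      by_contra hne
      have := Ideal.Quotient.nontrivial_iff.2 hne
      exact hJ.not_ge ringKrullDim_nonneg_of_nontrivial
    have : Subsingleton N := subsingleton_of_forall_eq 0 fun y ↦ by
      rw [← one_smul R y]
      exact Module.mem_annihilator.1 (hN (hJ' ▸ Submodule.mem_top)) y
    exact subsingleton_lc_of_subsingleton i
  | succ d ih =>
    intro J hJ N _ _ _ hN i hi
    obtain ⟨i, rfl⟩ : ∃ k, i = k + 1 := ⟨i - 1, by omega⟩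
    refine subsingleton_lc_of_forall_prime (fun q hq hJq ↦ ?_) hN
    have hq' : ringKrullDim (R ⧸ q) < (d + 1 : ℕ) :=
      (ringKrullDim_le_of_surjective (Ideal.Quotient.factor hJq)
        (Ideal.Quotient.factor_surjective hJq)).trans_lt hJ
    by_cases haq : a ≤ q
    · exact (isPowTorsion_of_le_annihilator
        (haq.trans Ideal.annihilator_quotient.ge)).subsingleton_lc i
    · obtain ⟨x, hxa, hxq⟩ := SetLike.not_le_iff_exists.1 haq
      have hann := sup_span_le_annihilator_quotient (T := R ⧸ q) Ideal.annihilator_quotient.ge x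
      have := ih _ (ringKrullDim_quotient_sup_span_lt hxq hq') hann i (by omega)
      refine subsingleton_lc_succ_of_smul_injective hxa ?_ i
      rw [injective_iff_map_eq_zero]
      intro y hy
      obtain ⟨y, rfl⟩ := Ideal.Quotient.mk_surjective y
      have hy' : x * y ∈ q := by
        rw [← Ideal.Quotient.eq_zero_iff_mem, map_mul, ← Ideal.Quotient.algebraMap_eq,
          ← Algebra.smul_def]
        exact hy
      exact Ideal.Quotient.eq_zero_iff_mem.2 ((hq.mem_or_mem hy').resolve_left hxq)

lemma exists_linearMap_quotient_ne_zero {M : Type} [AddCommGroup M] [Module R M]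
    [Module.Finite R M] {q : Ideal R} (hq : q ≠ ⊤) (h : Module.annihilator R M ≤ q) :
    ∃ f : M →ₗ[R] R ⧸ q, f ≠ 0 := by
  have := Ideal.Quotient.nontrivial_iff.2 hq
  by_contra! h0
  obtain ⟨r, hr, hreg⟩ := IsSMulRegular.subsingleton_linearMap_iff.1
    (subsingleton_of_forall_eq (0 : M →ₗ[R] R ⧸ q) h0)
  have h1 : r ∈ Module.annihilator R (R ⧸ q) := Ideal.annihilator_quotient.ge (h hr)
  exact one_ne_zero (hreg ((Module.mem_annihilator.1 h1 1).trans (smul_zero r).symm))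

/-- Vanishing of local cohomology above `c` passes to finite modules with smaller support. -/
lemma subsingleton_lc_of_annihilator_le {M : Type} [AddCommGroup M] [Module R M]
    [Module.Finite R M] {c : ℕ} (hM : ∀ i, c < i → Subsingleton (TopLC R a i M))
    {L : Type} [AddCommGroup L] [Module R L] [Module.Finite R L]
    (hL : Module.annihilator R M ≤ Module.annihilator R L) {i : ℕ} (hi : c < i) :
    Subsingleton (TopLC R a i L) := by
  obtain ⟨s, hs⟩ := IsNoetherian.noetherian a
  suffices H : ∀ k i, c < i → s.card < i + k → ∀ J : Ideal R, Module.annihilator R M ≤ J →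
      ∀ {L : Type} [AddCommGroup L] [Module R L] [Module.Finite R L],
        J ≤ Module.annihilator R L → Subsingleton (TopLC R a i L) from
    H (s.card + 1) i hi (by omega) _ le_rfl hL
  intro k
  induction k with
  | zero =>
    intro i _ hi J _ L _ _ _ _
    exact subsingleton_lc_of_card_lt s ⊥ (by rw [bot_sup_eq]; exact hs.symm)
      (isPowTorsion_of_le_annihilator bot_le) i hi
  | succ k ih =>
    intro i hci hi J
    induction J using IsNoetherian.induction with
    | hgt J ihJ =>
    intro hMJ L _ _ _ hJL
    refine subsingleton_lc_of_forall_prime (fun q hq hJq ↦ ?_) hJL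
    obtain hlt | rfl := hJq.lt_or_eq
    · exact ihJ q hlt (hMJ.trans hJq) Ideal.annihilator_quotient.ge
    obtain ⟨f, hf⟩ := exists_linearMap_quotient_ne_zero hq.ne_top hMJ
    have hker := ih (i + 1) (by omega) (by omega) _ le_rfl (L := LinearMap.ker f)
      (LinearMap.annihilator_le_of_injective _ (LinearMap.ker f).subtype_injective)
    have hrange : Subsingleton (TopLC R a i (LinearMap.range f)) := by
      have := hM i hci
      refine (lcMap_surjective_of_subsingleton (a := a) (f := (LinearMap.ker f).subtype)
        (g := f.rangeRestrict) (Submodule.subtype_injective _) f.surjective_rangeRestrict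
        ?_ i).subsingleton
      rw [LinearMap.exact_iff, LinearMap.ker_rangeRestrict, Submodule.range_subtype]
    have hquot : Subsingleton (TopLC R a i ((R ⧸ J) ⧸ LinearMap.range f)) := by
      have hle : J ≤ Module.annihilator R ((R ⧸ J) ⧸ LinearMap.range f) :=
        Ideal.annihilator_quotient.ge.trans
          (LinearMap.annihilator_le_of_surjective _ (Submodule.mkQ_surjective _))
      refine ihJ _ (lt_of_le_of_ne hle fun heq ↦ hf ?_) (hMJ.trans hle) le_rfl
      ext m
      obtain ⟨y, hy⟩ := Ideal.Quotient.mk_surjective (f m)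
      rw [← hy, LinearMap.zero_apply, Ideal.Quotient.eq_zero_iff_mem, heq, Module.mem_annihilator]
      intro z
      obtain ⟨z, rfl⟩ := Submodule.mkQ_surjective _ z
      obtain ⟨z, rfl⟩ := Ideal.Quotient.mk_surjective z
      rw [← map_smul]
      refine (Submodule.Quotient.mk_eq_zero _).2 ⟨z • m, ?_⟩
      rw [map_smul, ← hy]
      exact congrArg (Ideal.Quotient.mk J) (mul_comm z y)
    exact subsingleton_lc_middle (LinearMap.range f).subtype_injective
      (Submodule.mkQ_surjective _) (LinearMap.exact_subtype_mkQ _) i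

end Finite

section Attached

variable {R : Type} [CommRing R]

lemma IsSecondarySub.isPrime_radical {H : Type} [AddCommGroup H] [Module R H]
    {S : Submodule R H} (hS : IsSecondarySub R S) : S.annihilator.radical.IsPrime := by
  have hnil : ∀ x, (∃ n : ℕ, ∀ m ∈ S, x ^ n • m = 0) → x ∈ S.annihilator.radical :=
    fun x ⟨n, hn⟩ ↦ ⟨n, Submodule.mem_annihilator.2 hn⟩
  refine ⟨fun h ↦ hS.1 ?_, fun {x y} hxy ↦ ?_⟩
  · rwa [Ideal.radical_eq_top, Submodule.annihilator_eq_top_iff] at h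
  obtain hx | hx := hS.2 x
  · obtain hy | hy := hS.2 y
    · refine absurd ?_ hS.1
      obtain ⟨n, hn⟩ := hxy
      have hdiv : ∀ k : ℕ, ∀ m ∈ S, ∃ s ∈ S, (x * y) ^ k • s = m := by
        intro k
        induction k with
        | zero => exact fun m hm ↦ ⟨m, hm, by rw [pow_zero, one_smul]⟩
        | succ k ih =>
          intro m hm
          obtain ⟨s, hs, rfl⟩ := ih m hm
          obtain ⟨u, hu, rfl⟩ := hx s hs
          obtain ⟨v, hv, rfl⟩ := hy u hu
          exact ⟨v, hv, by rw [pow_succ, mul_smul, mul_smul]⟩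
      refine (Submodule.eq_bot_iff _).2 fun m hm ↦ ?_
      obtain ⟨s, hs, rfl⟩ := hdiv n m hm
      exact Submodule.mem_annihilator.1 hn s hs
    · exact Or.inr (hnil y hy)
  · exact Or.inl (hnil x hx)

lemma IsMinimalRep.radical_smul_top_ne_top [IsNoetherianRing R] {H : Type} [AddCommGroup H]
    [Module R H] {n : ℕ} {S : Fin n → Submodule R H} (hS : IsMinimalRep R S) (j : Fin n) :
    (S j).annihilator.radical • (⊤ : Submodule R H) ≠ ⊤ := by
  intro h
  obtain ⟨k, hk⟩ := Ideal.exists_radical_pow_le_of_fg (S j).annihilator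
    (IsNoetherian.noetherian _)
  have hpow : ∀ k : ℕ, (S j).annihilator.radical ^ k • (⊤ : Submodule R H) = ⊤ := by
    intro k
    induction k with
    | zero => rw [pow_zero, Ideal.one_eq_top, Submodule.top_smul]
    | succ k ih => rw [pow_succ, Submodule.mul_smul, h, ih]
  refine hS.2.2.2 j (le_top.trans ?_)
  have htop : (⊤ : Submodule R H) ≤ S j ⊔ ⨆ i ∈ ({j}ᶜ : Set (Fin n)), S i := by
    rw [← hS.2.1]
    refine iSup_le fun i ↦ ?_
    by_cases hij : i = j
    · exact hij ▸ le_sup_left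
    · exact le_sup_of_le_right (le_iSup₂_of_le i hij le_rfl)
  rw [← hpow k]
  refine (Submodule.smul_mono hk htop).trans ?_
  rw [Submodule.smul_sup, Submodule.annihilator_smul, bot_sup_eq]
  exact Submodule.smul_le_right

variable {a : Ideal R} {M : Type} [AddCommGroup M] [Module R M]

lemma annihilator_le_annihilator_lc (i : ℕ) :
    Module.annihilator R M ≤ Module.annihilator R (TopLC R a i M) := by
  intro r hr
  rw [Module.mem_annihilator] at hr ⊢
  intro y
  have hr0 : r • (LinearMap.id : M →ₗ[R] M) = 0 := LinearMap.ext hr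
  rw [← lcMap_zero (A := M) (B := M) i y, ← hr0, lcMap_smul, lcMap_id, LinearMap.id_apply]

lemma smul_lc_eq_top [IsNoetherianRing R] [Module.Finite R M] {c : ℕ}
    (hM : ∀ i, c < i → Subsingleton (TopLC R a i M)) {p : Ideal R}
    (hp : ∀ {N : Type} [AddCommGroup N] [Module R N] [Module.Finite R N],
      p ≤ Module.annihilator R N → Subsingleton (TopLC R a c N)) :
    p • (⊤ : Submodule R (TopLC R a c M)) = ⊤ := by
  classical
  obtain ⟨s, rfl⟩ := IsNoetherian.noetherian p
  let φ : (s → M) →ₗ[R] M := ∑ x : s, (x : R) • LinearMap.proj x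
  have hφ : ∀ (x : s) (m : M), φ (Pi.single x m) = (x : R) • m := fun x m ↦ by
    simp only [φ, LinearMap.sum_apply, LinearMap.smul_apply, LinearMap.proj_apply]
    rw [Finset.sum_eq_single x (fun y _ hy ↦ by rw [Pi.single_eq_of_ne hy, smul_zero])
      (fun h ↦ absurd (Finset.mem_univ x) h), Pi.single_eq_same]
  have hquot : Subsingleton (TopLC R a c (M ⧸ LinearMap.range φ)) := by
    refine hp (Submodule.span_le.2 fun x hx ↦ Module.mem_annihilator.2 fun y ↦ ?_)
    obtain ⟨y, rfl⟩ := Submodule.mkQ_surjective _ y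
    rw [← map_smul]
    exact (Submodule.Quotient.mk_eq_zero _).2 ⟨_, hφ ⟨x, hx⟩ y⟩
  have hker : Subsingleton (TopLC R a (c + 1) (LinearMap.ker φ)) := by
    refine subsingleton_lc_of_annihilator_le hM (fun r hr ↦ Module.mem_annihilator.2 fun y ↦ ?_)
      (Nat.lt_succ_self c)
    exact Subtype.ext (funext fun x ↦ Module.mem_annihilator.1 hr _)
  have hexact : Function.Exact (LinearMap.ker φ).subtype φ.rangeRestrict := by
    rw [LinearMap.exact_iff, LinearMap.ker_rangeRestrict, Submodule.range_subtype]
  have hsum : ∀ (t : Finset s) (z : TopLC R a c (s → M)),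
      lcMap a c (∑ x ∈ t, (x : R) • (LinearMap.proj x : (s → M) →ₗ[R] M)) z ∈
        Ideal.span (s : Set R) • (⊤ : Submodule R (TopLC R a c M)) := by
    intro t z
    induction t using Finset.induction with
    | empty => rw [Finset.sum_empty, lcMap_zero]; exact zero_mem _
    | insert x t hx ih =>
      rw [Finset.sum_insert hx, lcMap_add, lcMap_smul]
      exact add_mem (Submodule.smul_mem_smul (Ideal.subset_span x.2) Submodule.mem_top) ih
  refine eq_top_iff.2 fun y _ ↦ ?_
  obtain ⟨y, rfl⟩ := exists_lcMap_eq (a := a) (LinearMap.range φ).subtype_injective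
    (Submodule.mkQ_surjective _) (LinearMap.exact_subtype_mkQ _) c y (Subsingleton.elim _ _)
  obtain ⟨z, rfl⟩ := lcMap_surjective_of_subsingleton (a := a)
    (Submodule.subtype_injective _) φ.surjective_rangeRestrict hexact c y
  rw [← lcMap_comp]
  exact hsum Finset.univ z

lemma subsingleton_lc_of_cohDim_lt {i c : ℕ} (h : cohDim R a M = (c : WithBot ℕ∞))
    (hi : c < i) : Subsingleton (TopLC R a i M) := by
  by_contra hne
  have hle : (i : WithBot ℕ∞) ≤ cohDim R a M :=
    le_sSup ⟨i, rfl, not_subsingleton_iff_nontrivial.1 hne⟩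
  rw [h] at hle
  exact hi.not_ge (by exact_mod_cast hle)

end Attached

/-- Let `c := cd_R(a, M) ≠ -∞` for a finitely generated module `M` with
`H^c_a(M)` representable. If `p ∈ Att_R H^c_a(M)` and `dim R/p = c`, then
`cd_R(a, R/p) = c` (so `p` lies in `W`, i.e. `p ∈ Supp_R M` with
`dim R/p = cd_R(a, R/p) = c`). -/
theorem stmt_13 (R : Type) [CommRing R] [IsNoetherianRing R] (a : Ideal R)
    (M : Type) [AddCommGroup M] [Module R M] [Module.Finite R M]
    (c : ℕ) (hc : cohDim R a M = (c : WithBot ℕ∞))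
    (hrep : IsRepresentable R (TopLC R a c M))
    (p : Ideal R) (hp : p ∈ AttachedPrimes R (TopLC R a c M))
    (hdim : ringKrullDim (R ⧸ p) = (c : WithBot ℕ∞)) :
    cohDim R a (R ⧸ p) = (c : WithBot ℕ∞) ∧
      ∃ hpr : p.IsPrime, (⟨p, hpr⟩ : PrimeSpectrum R) ∈ Module.support R M := by
  obtain ⟨n, S, hS, j, rfl⟩ := hp
  set p := (S j).annihilator.radical
  have hpr : p.IsPrime := (hS.1 j).isPrime_radical
  have hM : ∀ i, c < i → Subsingleton (TopLC R a i M) := fun i ↦ subsingleton_lc_of_cohDim_lt hc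
  have hdim' : ringKrullDim (R ⧸ p) < (c + 1 : ℕ) := by
    rw [hdim]
    exact_mod_cast Nat.lt_succ_self c
  have hann : Module.annihilator R M ≤ p :=
    (annihilator_le_annihilator_lc c).trans
      ((LinearMap.annihilator_le_of_injective (S j).subtype (S j).subtype_injective).trans
        Ideal.le_radical)
  have hnt : Nontrivial (TopLC R a c (R ⧸ p)) := by
    by_contra h
    rw [not_nontrivial_iff_subsingleton] at h
    refine hS.radical_smul_top_ne_top j (smul_lc_eq_top hM
      (subsingleton_lc_of_forall_prime fun q _ hpq ↦ ?_))
    obtain hlt | rfl := hpq.lt_or_eq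
    · obtain ⟨x, hxq, hxp⟩ := SetLike.exists_of_lt hlt
      exact subsingleton_lc_of_ringKrullDim_lt c _ (ringKrullDim_quotient_sup_span_lt hxp hdim')
        ((sup_le hpq ((Ideal.span_singleton_le_iff_mem _).2 hxq)).trans
          Ideal.annihilator_quotient.ge) c le_rfl
    · exact h
  refine ⟨le_antisymm (sSup_le ?_) (le_sSup ⟨c, rfl, hnt⟩), hpr,
    Module.mem_support_iff_of_finite.2 hann⟩
  rintro _ ⟨i, rfl, hi⟩
  by_contra! hci
  have hci' : c < i := by exact_mod_cast hci
  exact not_subsingleton (TopLC R a i (R ⧸ p)) (subsingleton_lc_of_ringKrullDim_lt (c + 1) p hdim'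
    Ideal.annihilator_quotient.ge i hci')
end
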